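/- arXiv:2211.04073 — 11 statements merged into one kernel-verified Lean document; each statement's English description precedes it below -/
import Mathlib

section
/- Let F be a field of characteristic p > 0 and let R be a finite-dimensional commutative F-algebra admitting a p-basis of length r, where r ≥ 2. Then there exist F-subalgebras Λ₁, Λ₂ ⊆ R, each admitting a p-basis of length r − 1, such that Λ₁ ∩ Λ₂ = F·1. -/
/-- A `p`-basis of length `r` of a commutative `F`-algebra `R`: a tuple
`ω : Fin r → R` such that each `ω i ^ p` lies in `F·1` and the induced map
`F[T₁,…,T_r]/(T₁^p − ω₁^p, …, T_r^p − ω_r^p) → R`, `Tᵢ ↦ ωᵢ`, is bijective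
(equivalently, `aeval ω` is surjective with kernel the ideal generated by the
`Tᵢ^p − ωᵢ^p`). -/
def IsPBasis (F : Type*) [CommRing F] {R : Type*} [CommRing R] [Algebra F R]
    (p : ℕ) {r : ℕ} (ω : Fin r → R) : Prop :=
  ∃ c : Fin r → F,
    (∀ i, ω i ^ p = algebraMap F R (c i)) ∧
    Function.Surjective (MvPolynomial.aeval (R := F) ω) ∧
    RingHom.ker (MvPolynomial.aeval (R := F) ω).toRingHom =
      Ideal.span (Set.range fun i => MvPolynomial.X i ^ p - MvPolynomial.C (c i))

open Polynomial Module

section TruncatedPolynomials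

variable {F R : Type*} [Field F] [CommRing R] [Algebra F R] {p : ℕ}

/-- The `F`-linear map sending a tuple `v` of elements of a subalgebra `B` to `∑ j < p, v j * x ^ j`. -/
def powCombination (p : ℕ) (B : Subalgebra F R) (x : R) : (Fin p → B) →ₗ[F] R where
  toFun v := ∑ j, (v j : R) * x ^ (j : ℕ)
  map_add' v w := by simp [add_mul, Finset.sum_add_distrib]
  map_smul' a v := by simp [Finset.smul_sum]

lemma powCombination_apply (B : Subalgebra F R) (x : R) (v : Fin p → B) :
    powCombination p B x v = ∑ j, (v j : R) * x ^ (j : ℕ) := rfl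

lemma powCombination_coeff (B : Subalgebra F R) (x : R) (q : R[X]) (hq : ∀ n, q.coeff n ∈ B)
    (hd : q.natDegree < p) :
    powCombination p B x (fun j => ⟨q.coeff j, hq j⟩) = q.eval x := by
  rw [powCombination_apply, eval_eq_sum_range' hd,
    Fin.sum_univ_eq_sum_range (fun j => q.coeff j * x ^ j)]

/-- An element adjoined to `B` is the value of a polynomial over `B` of degree less than `p`. -/
lemma exists_polynomial_of_mem_adjoin_insert (hp : 0 < p) {B : Subalgebra F R} {x : R} {c : F}
    (hx : x ^ p = algebraMap F R c) {y : R} (hy : y ∈ Algebra.adjoin F (insert x (B : Set R))) :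
    ∃ q : R[X], (∀ n, q.coeff n ∈ B) ∧ q.natDegree < p ∧ q.eval x = y := by
  have key : ∃ q : B[X], aeval x q = y := by
    induction hy using Algebra.adjoin_induction with
    | mem z hz =>
      rcases hz with rfl | hz
      · exact ⟨X, by simp⟩
      · exact ⟨C ⟨z, hz⟩, by rw [aeval_C]; rfl⟩
    | algebraMap r => exact ⟨C (algebraMap F B r), by rw [aeval_C]; rfl⟩
    | add a b _ _ ha hb =>
      obtain ⟨q, rfl⟩ := ha
      obtain ⟨q', rfl⟩ := hb
      exact ⟨q + q', by simp⟩
    | mul a b _ _ ha hb =>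
      obtain ⟨q, rfl⟩ := ha
      obtain ⟨q', rfl⟩ := hb
      exact ⟨q * q', by simp⟩
  obtain ⟨q, rfl⟩ := key
  rcases subsingleton_or_nontrivial R with hR | hR
  · exact ⟨0, by simp, by simpa using hp, Subsingleton.elim _ _⟩
  have hm : (X ^ p - C (algebraMap F B c)).Monic := monic_X_pow_sub_C _ hp.ne'
  refine ⟨(q %ₘ (X ^ p - C (algebraMap F B c))).map (algebraMap B R), fun n => ?_, ?_, ?_⟩
  · rw [coeff_map]
    exact SetLike.coe_mem _
  · refine natDegree_map_le.trans_lt ?_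
    have h := natDegree_modByMonic_lt q hm (fun h => by
      have := congrArg natDegree h
      rw [natDegree_X_pow_sub_C, natDegree_one] at this
      exact hp.ne' this)
    rwa [natDegree_X_pow_sub_C] at h
  · rw [eval_map_algebraMap]
    conv_rhs => rw [← modByMonic_add_div q (X ^ p - C (algebraMap F B c))]
    have h0 : aeval x (X ^ p - C (algebraMap F B c) : B[X]) = 0 := by
      rw [map_sub, map_pow, aeval_X, aeval_C, hx]
      exact sub_self _
    rw [map_add, map_mul, h0, zero_mul, add_zero]

lemma range_powCombination (hp : 0 < p) (B : Subalgebra F R) {x : R} {c : F}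
    (hx : x ^ p = algebraMap F R c) :
    LinearMap.range (powCombination p B x) =
      Subalgebra.toSubmodule (Algebra.adjoin F (insert x (B : Set R))) := by
  apply le_antisymm
  · rintro _ ⟨v, rfl⟩
    rw [powCombination_apply, Subalgebra.mem_toSubmodule]
    exact Subalgebra.sum_mem _ fun j _ => Subalgebra.mul_mem _
      (Algebra.subset_adjoin (Set.mem_insert_of_mem _ (v j).2))
      (Subalgebra.pow_mem _ (Algebra.subset_adjoin (R := F) (Set.mem_insert x (B : Set R))) _)
  · intro y hy
    obtain ⟨q, hq, hd, rfl⟩ := exists_polynomial_of_mem_adjoin_insert hp hx hy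
    exact ⟨_, powCombination_coeff B x q hq hd⟩

lemma finrank_pi_subalgebra (p : ℕ) (B : Subalgebra F R) [Module.Finite F B] :
    finrank F (Fin p → B) = p * finrank F B := by
  simp [Module.finrank_pi_fintype]

lemma finite_and_finrank_adjoin_insert_le (hp : 0 < p) (B : Subalgebra F R) [Module.Finite F B]
    {x : R} {c : F} (hx : x ^ p = algebraMap F R c) :
    Module.Finite F (Algebra.adjoin F (insert x (B : Set R))) ∧
      finrank F (Algebra.adjoin F (insert x (B : Set R))) ≤ p * finrank F B := by
  have h := range_powCombination hp B hx
  constructor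
  · change Module.Finite F (Subalgebra.toSubmodule (Algebra.adjoin F (insert x (B : Set R))))
    rw [← h]
    infer_instance
  · change finrank F (Subalgebra.toSubmodule (Algebra.adjoin F (insert x (B : Set R)))) ≤ _
    rw [← h, ← finrank_pi_subalgebra]
    exact LinearMap.finrank_range_le _

lemma injective_powCombination_iff (hp : 0 < p) (B : Subalgebra F R) [Module.Finite F B]
    {x : R} {c : F} (hx : x ^ p = algebraMap F R c) :
    Function.Injective (powCombination p B x) ↔
      finrank F (Algebra.adjoin F (insert x (B : Set R))) = p * finrank F B := by
  change _ ↔ finrank F (Subalgebra.toSubmodule (Algebra.adjoin F (insert x (B : Set R)))) = _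
  rw [← range_powCombination hp B hx, ← finrank_pi_subalgebra]
  refine ⟨LinearMap.finrank_range_of_inj, fun h => ?_⟩
  have h' := LinearMap.finrank_range_add_finrank_ker (powCombination p B x)
  rw [← LinearMap.ker_eq_bot]
  exact Submodule.finrank_eq_zero.mp (by omega)

lemma injective_powCombination_of_le {A B : Subalgebra F R} (hAB : A ≤ B) {x : R}
    (h : Function.Injective (powCombination p B x)) :
    Function.Injective (powCombination p A x) := by
  intro v w hvw
  have := @h (fun j => ⟨v j, hAB (v j).2⟩) (fun j => ⟨w j, hAB (w j).2⟩) hvw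
  funext j
  exact Subtype.ext (congrArg (fun z : B => (z : R)) (congrFun this j))

lemma eq_of_eval_eq {B : Subalgebra F R} {x : R} (h : Function.Injective (powCombination p B x))
    {q q' : R[X]} (hq : ∀ n, q.coeff n ∈ B) (hq' : ∀ n, q'.coeff n ∈ B)
    (hd : q.natDegree < p) (hd' : q'.natDegree < p) (he : q.eval x = q'.eval x) : q = q' := by
  rw [← powCombination_coeff B x q hq hd, ← powCombination_coeff B x q' hq' hd'] at he
  ext n
  rcases lt_or_ge n p with hn | hn
  · exact congrArg Subtype.val (congrFun (h he) ⟨n, hn⟩)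
  · rw [coeff_eq_zero_of_natDegree_lt (hd.trans_le hn),
      coeff_eq_zero_of_natDegree_lt (hd'.trans_le hn)]

lemma taylor_coeff_mem {B : Subalgebra F R} {q : R[X]} (hq : ∀ n, q.coeff n ∈ B) {u : R}
    (hu : u ∈ B) (n : ℕ) : (taylor u q).coeff n ∈ B := by
  rw [taylor_coeff, eval_eq_sum_range]
  refine Subalgebra.sum_mem _ fun i _ => Subalgebra.mul_mem _ ?_ (Subalgebra.pow_mem _ hu _)
  rw [hasseDeriv_coeff]
  exact Subalgebra.mul_mem _ (natCast_mem _ _) (hq _)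

lemma taylor_coeff_of_natDegree_eq_succ {q : R[X]} {m : ℕ} (hq : q.natDegree = m + 1) (u : R) :
    (taylor u q).coeff m = q.coeff m + (m + 1 : ℕ) * q.coeff (m + 1) * u := by
  have hd : (hasseDeriv m q).natDegree < 2 := by
    have := natDegree_hasseDeriv_le q m
    omega
  rw [taylor_coeff, eval_eq_sum_range' hd]
  simp [Finset.sum_range_succ, hasseDeriv_coeff, add_comm 1 m]

/-- Adjoining a new generator `x` to `A` and its translate `x - u` to `C` keeps the
intersection trivial as long as `u` is not in `A + C`. -/
lemma adjoin_insert_inf_adjoin_insert_sub (hp : 0 < p) [CharP F p] {A B C : Subalgebra F R}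
    (hA : A ≤ B) (hC : C ≤ B) (hAC : A ⊓ C = ⊥) {x u : R} {c d : F}
    (hx : x ^ p = algebraMap F R c) (hxu : (x - u) ^ p = algebraMap F R d)
    (hinj : Function.Injective (powCombination p B x)) (hu : u ∈ B)
    (hu' : u ∉ Subalgebra.toSubmodule A ⊔ Subalgebra.toSubmodule C) :
    Algebra.adjoin F (insert x (A : Set R)) ⊓ Algebra.adjoin F (insert (x - u) (C : Set R)) =
      ⊥ := by
  rw [eq_bot_iff]
  rintro y ⟨hy₁, hy₂⟩
  obtain ⟨q₁, hq₁, hd₁, rfl⟩ := exists_polynomial_of_mem_adjoin_insert hp hx hy₁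
  obtain ⟨q₂, hq₂, hd₂, he⟩ := exists_polynomial_of_mem_adjoin_insert hp hxu hy₂
  have hq : q₁ = taylor (-u) q₂ := by
    refine eq_of_eval_eq hinj (fun n => hA (hq₁ n))
      (taylor_coeff_mem (fun n => hC (hq₂ n)) (neg_mem hu)) hd₁ ?_ ?_
    · rwa [natDegree_taylor]
    · rw [taylor_eval, ← sub_eq_add_neg, he]
  have hdeg : q₁.natDegree = q₂.natDegree := by rw [hq, natDegree_taylor]
  have hlead : q₁.coeff q₂.natDegree = q₂.coeff q₂.natDegree := by
    rw [hq, coeff_taylor_natDegree, leadingCoeff]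
  have hmem : q₂.coeff q₂.natDegree ∈ (⊥ : Subalgebra F R) := by
    rw [← hAC]
    exact ⟨hlead ▸ hq₁ _, hq₂ _⟩
  rcases hm : q₂.natDegree with _ | m
  · rw [hm] at hdeg hmem hlead
    rw [eq_C_of_natDegree_eq_zero hdeg, eval_C, hlead]
    exact hmem
  · exfalso
    apply hu'
    obtain ⟨l, hl⟩ := Algebra.mem_bot.mp hmem
    have hl0 : l ≠ 0 := by
      rintro rfl
      rw [map_zero, eq_comm, coeff_natDegree, leadingCoeff_eq_zero] at hl
      simp [hl] at hm
    have hm0 : ((m + 1 : ℕ) : F) ≠ 0 := by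
      rw [Ne, CharP.cast_eq_zero_iff F p]
      intro h
      have := Nat.le_of_dvd m.succ_pos h
      omega
    have hcoeff : q₂.coeff m - q₁.coeff m = (((m + 1 : ℕ) : F) * l) • u := by
      rw [hq, taylor_coeff_of_natDegree_eq_succ hm, Algebra.smul_def, map_mul, map_natCast, hl, hm]
      ring
    have hu_eq : u = (((m + 1 : ℕ) : F) * l)⁻¹ • (q₂.coeff m - q₁.coeff m) := by
      rw [hcoeff, inv_smul_smul₀ (mul_ne_zero hm0 hl0)]
    rw [hu_eq]
    exact Submodule.smul_mem _ _ (Submodule.sub_mem _ (Submodule.mem_sup_right (hq₂ m))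
      (Submodule.mem_sup_left (hq₁ m)))

lemma adjoin_range_snoc {k : ℕ} (a : Fin k → R) (x : R) :
    Algebra.adjoin F (Set.range (Fin.snoc a x : Fin (k + 1) → R)) =
      Algebra.adjoin F (insert x (Algebra.adjoin F (Set.range a) : Set R)) := by
  rw [Fin.range_snoc, Algebra.adjoin_insert_adjoin]

lemma finite_and_finrank_adjoin_range_le (hp : 0 < p) :
    ∀ {k : ℕ} (s : Fin k → R) (c : Fin k → F), (∀ i, s i ^ p = algebraMap F R (c i)) →
      Module.Finite F (Algebra.adjoin F (Set.range s)) ∧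
        finrank F (Algebra.adjoin F (Set.range s)) ≤ p ^ k := by
  intro k
  induction k with
  | zero =>
    intro s c _
    rw [Set.range_eq_empty, Algebra.adjoin_empty]
    refine ⟨inferInstance, ?_⟩
    rcases subsingleton_or_nontrivial R with hR | hR
    · simp [finrank_zero_of_subsingleton]
    · simp [Subalgebra.finrank_bot]
  | succ k ih =>
    intro s c hs
    obtain ⟨hf, hle⟩ := ih (fun i => s i.castSucc) (fun i => c i.castSucc) fun i => hs _
    have hs' : s = Fin.snoc (fun i => s i.castSucc) (s (Fin.last k)) := (Fin.snoc_init_self s).symm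
    rw [hs', adjoin_range_snoc]
    obtain ⟨hf', hle'⟩ := finite_and_finrank_adjoin_insert_le hp
      (Algebra.adjoin F (Set.range fun i : Fin k => s i.castSucc)) (hs (Fin.last k))
    refine ⟨hf', hle'.trans ?_⟩
    rw [pow_succ, mul_comm]
    exact Nat.mul_le_mul_right _ hle

/-- If every `p`-th power lies in `F` and `ω` generates a subalgebra of maximal dimension
`p ^ (k + 1)`, then this subalgebra contains two subalgebras of dimension `p ^ k`, generated by
`k` elements each, which meet only in `F`. -/
lemma exists_adjoin_range_inf_eq_bot (hp : 2 ≤ p) [CharP F p]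
    (H : ∀ x : R, ∃ c : F, x ^ p = algebraMap F R c) :
    ∀ {k : ℕ} (ω : Fin (k + 1) → R), finrank F (Algebra.adjoin F (Set.range ω)) = p ^ (k + 1) →
      ∃ a b : Fin k → R,
        Algebra.adjoin F (Set.range a) ≤ Algebra.adjoin F (Set.range ω) ∧
        Algebra.adjoin F (Set.range b) ≤ Algebra.adjoin F (Set.range ω) ∧
        finrank F (Algebra.adjoin F (Set.range a)) = p ^ k ∧
        finrank F (Algebra.adjoin F (Set.range b)) = p ^ k ∧
        Algebra.adjoin F (Set.range a) ⊓ Algebra.adjoin F (Set.range b) = ⊥ := by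
  have hp0 : 0 < p := by omega
  intro k
  induction k with
  | zero =>
    intro ω hω
    have : Nontrivial R := by
      by_contra hR
      rw [not_nontrivial_iff_subsingleton] at hR
      rw [finrank_zero_of_subsingleton] at hω
      simp at hω
      omega
    refine ⟨Fin.elim0, Fin.elim0, ?_⟩
    rw [Set.range_eq_empty, Algebra.adjoin_empty]
    simp [Subalgebra.finrank_bot]
  | succ k ih =>
    intro ω hω
    obtain ⟨ω', x, rfl⟩ : ∃ (ω' : Fin (k + 1) → R) (x : R), ω = Fin.snoc ω' x :=
      ⟨_, _, (Fin.snoc_init_self ω).symm⟩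
    rw [adjoin_range_snoc] at hω
    set B := Algebra.adjoin F (Set.range ω') with hB
    choose cp hcp using H
    obtain ⟨hfB, hleB⟩ := finite_and_finrank_adjoin_range_le hp0 ω' (fun i => cp (ω' i))
      fun i => hcp _
    rw [← hB] at hfB hleB
    have hle := (finite_and_finrank_adjoin_insert_le hp0 B (hcp x)).2
    have hBeq : finrank F B = p ^ (k + 1) := by
      apply le_antisymm hleB
      rw [hω, pow_succ, mul_comm] at hle
      exact Nat.le_of_mul_le_mul_left hle hp0
    have hωB : finrank F (Algebra.adjoin F (insert x (B : Set R))) = p * finrank F B := by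
      rw [hω, hBeq, pow_succ, mul_comm]
    have hinj := (injective_powCombination_iff hp0 B (hcp x)).mpr hωB
    obtain ⟨a, b, haB, hbB, ha, hb, hab⟩ := ih ω' hBeq
    have hfa := (finite_and_finrank_adjoin_range_le hp0 a (fun i => cp (a i)) fun i => hcp _).1
    have hfb := (finite_and_finrank_adjoin_range_le hp0 b (fun i => cp (b i)) fun i => hcp _).1
    set A := Algebra.adjoin F (Set.range a) with hA
    set C := Algebra.adjoin F (Set.range b) with hC
    obtain ⟨u, huB, hu⟩ : ∃ u ∈ B, u ∉ Subalgebra.toSubmodule A ⊔ Subalgebra.toSubmodule C := by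
      by_contra! hcon
      have hfA' : FiniteDimensional F (Subalgebra.toSubmodule A) := hfa
      have hfC' : FiniteDimensional F (Subalgebra.toSubmodule C) := hfb
      have : Nontrivial R := by
        by_contra hR
        rw [not_nontrivial_iff_subsingleton] at hR
        rw [finrank_zero_of_subsingleton] at hBeq
        exact (pow_pos hp0 _).ne hBeq
      have h1 := Submodule.finrank_mono (R := F) (s := Subalgebra.toSubmodule B) hcon
      have h2 := Submodule.finrank_sup_add_finrank_inf_eq (Subalgebra.toSubmodule A)
        (Subalgebra.toSubmodule C)
      have h3 : finrank F ↥(Subalgebra.toSubmodule A ⊓ Subalgebra.toSubmodule C) = 1 := by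
        change finrank F ↥(A ⊓ C) = 1
        rw [hab, Subalgebra.finrank_bot]
      change finrank F B ≤ _ at h1
      change _ = finrank F A + finrank F C at h2
      rw [hBeq, pow_succ] at h1
      have := Nat.mul_le_mul_left (p ^ k) hp
      omega
    have hx_adj : x ∈ Algebra.adjoin F (insert x (B : Set R)) :=
      Algebra.subset_adjoin (Set.mem_insert _ _)
    have hB_adj : (B : Set R) ⊆ Algebra.adjoin F (insert x (B : Set R)) :=
      (Set.subset_insert _ _).trans Algebra.subset_adjoin
    have hxu : Algebra.adjoin F (insert (x - u) (B : Set R)) =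
        Algebra.adjoin F (insert x (B : Set R)) := by
      apply le_antisymm
      · refine Algebra.adjoin_le (Set.insert_subset ?_ hB_adj)
        exact sub_mem hx_adj (hB_adj huB)
      · have hB_adj' : (B : Set R) ⊆ Algebra.adjoin F (insert (x - u) (B : Set R)) :=
          (Set.subset_insert _ _).trans Algebra.subset_adjoin
        refine Algebra.adjoin_le (Set.insert_subset ?_ hB_adj')
        have := add_mem (Algebra.subset_adjoin (R := F) (Set.mem_insert (x - u) (B : Set R)))
          (hB_adj' huB)
        rwa [sub_add_cancel] at this
    have hinj' : Function.Injective (powCombination p B (x - u)) := by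
      rw [injective_powCombination_iff hp0 B (hcp (x - u)), hxu, hωB]
    refine ⟨Fin.snoc a x, Fin.snoc b (x - u), ?_⟩
    rw [adjoin_range_snoc, adjoin_range_snoc, adjoin_range_snoc, ← hA, ← hB, ← hC]
    refine ⟨Algebra.adjoin_mono (Set.insert_subset_insert haB), ?_, ?_, ?_, ?_⟩
    · rw [← hxu]
      exact Algebra.adjoin_mono (Set.insert_subset_insert hbB)
    · rw [(injective_powCombination_iff hp0 A (hcp x)).mp (injective_powCombination_of_le haB hinj),
        ha, pow_succ, mul_comm]
    · rw [(injective_powCombination_iff hp0 C (hcp (x - u))).mp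
        (injective_powCombination_of_le hbB hinj'), hb, pow_succ, mul_comm]
    · exact adjoin_insert_inf_adjoin_insert_sub hp0 haB hbB hab (hcp x) (hcp (x - u)) hinj huB hu

end TruncatedPolynomials

section Dimension

/-- There is an algebra of dimension `p ^ k` generated by `k` elements with prescribed `p`-th
powers. -/
lemma exists_algebra_finrank_eq_pow.{u} (F : Type u) [Field F] {p : ℕ} (hp : 0 < p) :
    ∀ {k : ℕ} (c : Fin k → F), ∃ (S : Type u) (_ : CommRing S) (_ : Algebra F S) (s : Fin k → S),
      (∀ i, s i ^ p = algebraMap F S (c i)) ∧ Algebra.adjoin F (Set.range s) = ⊤ ∧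
        finrank F S = p ^ k := by
  intro k
  induction k with
  | zero =>
    intro c
    refine ⟨F, inferInstance, inferInstance, Fin.elim0, fun i => i.elim0, ?_, by simp⟩
    rw [Set.range_eq_empty, Algebra.adjoin_empty]
    exact Subsingleton.elim _ _
  | succ k ih =>
    intro c
    obtain ⟨S, _, _, s, hs, htop, hrank⟩ := ih fun i => c i.castSucc
    have : Nontrivial S := by
      by_contra hS
      rw [not_nontrivial_iff_subsingleton] at hS
      rw [finrank_zero_of_subsingleton] at hrank
      exact (pow_pos hp _).ne hrank
    set f : S[X] := X ^ p - C (algebraMap F S (c (Fin.last k))) with hf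
    have hm : f.Monic := monic_X_pow_sub_C _ hp.ne'
    refine ⟨AdjoinRoot f, inferInstance, inferInstance,
      Fin.snoc (fun i => algebraMap S (AdjoinRoot f) (s i)) (AdjoinRoot.root f), ?_, ?_, ?_⟩
    · intro i
      refine Fin.lastCases ?_ (fun i => ?_) i
      · rw [Fin.snoc_last, IsScalarTower.algebraMap_apply F S (AdjoinRoot f), ← sub_eq_zero]
        have := AdjoinRoot.eval₂_root f
        rwa [hf, eval₂_sub, eval₂_pow, eval₂_X, eval₂_C] at this
      · rw [Fin.snoc_castSucc, ← map_pow, hs, ← IsScalarTower.algebraMap_apply]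
    · rw [Fin.range_snoc]
      set T := Algebra.adjoin F (insert (AdjoinRoot.root f)
        (Set.range fun i => algebraMap S (AdjoinRoot f) (s i))) with hT
      have hS : ∀ z : S, algebraMap S (AdjoinRoot f) z ∈ T := by
        intro z
        have hz : z ∈ Algebra.adjoin F (Set.range s) := htop ▸ Algebra.mem_top
        have hle : Algebra.adjoin F (Set.range s) ≤
            T.comap (IsScalarTower.toAlgHom F S (AdjoinRoot f)) := by
          refine Algebra.adjoin_le ?_
          rintro _ ⟨i, rfl⟩
          exact Algebra.subset_adjoin (Set.mem_insert_of_mem _ ⟨i, rfl⟩)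
        exact hle hz
      rw [eq_top_iff]
      rintro y -
      obtain ⟨q, rfl⟩ := AdjoinRoot.mk_surjective y
      rw [← AdjoinRoot.aeval_eq, aeval_eq_sum_range]
      refine Subalgebra.sum_mem _ fun i _ => ?_
      rw [Algebra.smul_def]
      exact Subalgebra.mul_mem _ (hS _)
        (Subalgebra.pow_mem _ (Algebra.subset_adjoin (Set.mem_insert _ _)) _)
    · have : Module.Free S (AdjoinRoot f) := .of_basis (AdjoinRoot.powerBasis' hm).basis
      rw [← Module.finrank_mul_finrank F S (AdjoinRoot f), hrank,
        (AdjoinRoot.powerBasis' hm).finrank, AdjoinRoot.powerBasis'_dim, hf,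
        natDegree_X_pow_sub_C, pow_succ]

variable {F R : Type*} [Field F] [CommRing R] [Algebra F R] {p : ℕ}

lemma IsPBasis.finrank_ge [Module.Finite F R] (hp : 0 < p) {k : ℕ} {ω : Fin k → R}
    (h : IsPBasis F p ω) : p ^ k ≤ finrank F R := by
  obtain ⟨c, -, hsurj, hker⟩ := h
  obtain ⟨S, _, _, s, hs, htop, hrank⟩ := exists_algebra_finrank_eq_pow F hp c
  have hker' : ∀ q ∈ RingHom.ker (MvPolynomial.aeval (R := F) ω),
      MvPolynomial.aeval (R := F) s q = 0 := by
    intro q hq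
    have hle : Ideal.span (Set.range fun i => MvPolynomial.X i ^ p - MvPolynomial.C (c i)) ≤
        RingHom.ker (MvPolynomial.aeval (R := F) s) := by
      rw [Ideal.span_le]
      rintro _ ⟨i, rfl⟩
      simp [RingHom.mem_ker, hs]
    exact hle (hker ▸ hq)
  let e := Ideal.quotientKerAlgEquivOfSurjective hsurj
  let φ : R →ₐ[F] S := (Ideal.Quotient.liftₐ _ (MvPolynomial.aeval (R := F) s) hker').comp
    (e.symm : R →ₐ[F] _)
  have hφ : Function.Surjective φ := by
    have hs_surj : Function.Surjective (MvPolynomial.aeval (R := F) s) := by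
      rw [← AlgHom.range_eq_top, ← Algebra.adjoin_range_eq_range_aeval, htop]
    intro y
    obtain ⟨q, rfl⟩ := hs_surj y
    refine ⟨e (Ideal.Quotient.mk _ q), ?_⟩
    simp only [φ, AlgHom.comp_apply, AlgEquiv.coe_toAlgHom, AlgEquiv.symm_apply_apply]
    rfl
  rw [← hrank]
  exact LinearMap.finrank_le_finrank_of_surjective (f := φ.toLinearMap) hφ

lemma isPBasis_of_finrank_eq (hp : 0 < p) {k : ℕ} {s : Fin k → R} {c : Fin k → F}
    (hs : ∀ i, s i ^ p = algebraMap F R (c i)) (htop : Algebra.adjoin F (Set.range s) = ⊤)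
    (hrank : finrank F R = p ^ k) : IsPBasis F p s := by
  have hsurj : Function.Surjective (MvPolynomial.aeval (R := F) s) := by
    rw [← AlgHom.range_eq_top, ← Algebra.adjoin_range_eq_range_aeval, htop]
  refine ⟨c, hs, hsurj, ?_⟩
  set I : Ideal (MvPolynomial (Fin k) F) :=
    Ideal.span (Set.range fun i => MvPolynomial.X i ^ p - MvPolynomial.C (c i)) with hI
  have hle : ∀ q ∈ I, MvPolynomial.aeval (R := F) s q = 0 := by
    have : I ≤ RingHom.ker (MvPolynomial.aeval (R := F) s) := by
      rw [hI, Ideal.span_le]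
      rintro _ ⟨i, rfl⟩
      simp [RingHom.mem_ker, hs]
    exact this
  refine le_antisymm (fun q hq => ?_) hle
  let t : Fin k → MvPolynomial (Fin k) F ⧸ I := fun i => Ideal.Quotient.mk I (MvPolynomial.X i)
  have ht : ∀ i, t i ^ p = algebraMap F _ (c i) := by
    intro i
    rw [← map_pow, ← sub_eq_zero]
    change Ideal.Quotient.mk I (MvPolynomial.X i ^ p) - Ideal.Quotient.mk I (MvPolynomial.C (c i))
      = 0
    rw [← map_sub, Ideal.Quotient.eq_zero_iff_mem]
    exact Ideal.subset_span ⟨i, rfl⟩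
  have htt : Algebra.adjoin F (Set.range t) = ⊤ := by
    have h : MvPolynomial.aeval (R := F) t = Ideal.Quotient.mkₐ F I := by
      ext i
      simp [t]
    rw [Algebra.adjoin_range_eq_range_aeval, h, AlgHom.range_eq_top]
    exact Ideal.Quotient.mkₐ_surjective F I
  obtain ⟨hfin, hrk⟩ := finite_and_finrank_adjoin_range_le hp t c ht
  rw [htt] at hfin hrk
  have : Module.Finite F (MvPolynomial (Fin k) F ⧸ I) :=
    Module.Finite.equiv (Subalgebra.topEquiv (R := F)).toLinearEquiv
  rw [(Subalgebra.topEquiv (R := F)).toLinearEquiv.finrank_eq] at hrk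
  let φ := Ideal.Quotient.liftₐ I (MvPolynomial.aeval (R := F) s) hle
  have hφ : LinearMap.range φ.toLinearMap = ⊤ := by
    rw [LinearMap.range_eq_top]
    intro y
    obtain ⟨q, rfl⟩ := hsurj y
    exact ⟨Ideal.Quotient.mk _ q, rfl⟩
  have hsum := LinearMap.finrank_range_add_finrank_ker φ.toLinearMap
  rw [hφ, finrank_top, hrank] at hsum
  have hker : LinearMap.ker φ.toLinearMap = ⊥ := Submodule.finrank_eq_zero.mp (by omega)
  rw [← Ideal.Quotient.eq_zero_iff_mem]
  refine LinearMap.ker_eq_bot'.mp hker _ ?_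
  exact hq

lemma exists_pow_eq_algebraMap [CharP F p] [Fact p.Prime] {k : ℕ} {s : Fin k → R} {c : Fin k → F}
    (hs : ∀ i, s i ^ p = algebraMap F R (c i)) (htop : Algebra.adjoin F (Set.range s) = ⊤)
    (x : R) : ∃ d : F, x ^ p = algebraMap F R d := by
  rcases subsingleton_or_nontrivial R with hR | hR
  · exact ⟨0, Subsingleton.elim _ _⟩
  have : CharP R p := charP_of_injective_algebraMap (algebraMap F R).injective p
  have hx : x ∈ Algebra.adjoin F (Set.range s) := htop ▸ Algebra.mem_top
  induction hx using Algebra.adjoin_induction with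
  | mem z hz =>
    obtain ⟨i, rfl⟩ := hz
    exact ⟨c i, hs i⟩
  | algebraMap a => exact ⟨a ^ p, by rw [map_pow]⟩
  | add a b _ _ ha hb =>
    obtain ⟨d, hd⟩ := ha
    obtain ⟨e, he⟩ := hb
    exact ⟨d + e, by rw [add_pow_char, hd, he, map_add]⟩
  | mul a b _ _ ha hb =>
    obtain ⟨d, hd⟩ := ha
    obtain ⟨e, he⟩ := hb
    exact ⟨d * e, by rw [mul_pow, hd, he, map_mul]⟩

lemma exists_isPBasis_adjoin (hp : 0 < p) (H : ∀ x : R, ∃ c : F, x ^ p = algebraMap F R c)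
    {k : ℕ} (a : Fin k → R) (ha : finrank F (Algebra.adjoin F (Set.range a)) = p ^ k) :
    ∃ a' : Fin k → Algebra.adjoin F (Set.range a), IsPBasis F p a' := by
  choose c hc using fun i => H (a i)
  refine ⟨fun i => ⟨a i, Algebra.subset_adjoin ⟨i, rfl⟩⟩,
    isPBasis_of_finrank_eq hp (c := c) (fun i => Subtype.ext (hc i)) ?_ ha⟩
  have h := Algebra.adjoin_adjoin_coe_preimage (R := F) (s := Set.range a)
  rw [← h]
  congr 1
  ext y
  constructor
  · rintro ⟨i, rfl⟩
    exact ⟨i, rfl⟩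
  · rintro ⟨i, hi⟩
    exact ⟨i, Subtype.ext hi⟩

end Dimension

/-- Over a field `F` of characteristic `p > 0`, if a
finite-dimensional commutative `F`-algebra `R` admits a `p`-basis of length
`r ≥ 2`, then there are `F`-subalgebras `Λ₁, Λ₂ ⊆ R`, each admitting a
`p`-basis of length `r − 1`, with `Λ₁ ∩ Λ₂ = F·1`. -/
theorem statement0 (F R : Type*) [Field F] [CommRing R] [Algebra F R]
    [FiniteDimensional F R] (p : ℕ) (hp : 0 < p) [CharP F p]
    (r : ℕ) (hr : 2 ≤ r) (ω : Fin r → R) (hω : IsPBasis F p ω) :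
    ∃ Λ₁ Λ₂ : Subalgebra F R,
      (∃ ω₁ : Fin (r - 1) → Λ₁, IsPBasis F p ω₁) ∧
      (∃ ω₂ : Fin (r - 1) → Λ₂, IsPBasis F p ω₂) ∧
      Λ₁ ⊓ Λ₂ = ⊥ := by
  have hprime : p.Prime := (CharP.char_is_prime_or_zero F p).resolve_right hp.ne'
  have : Fact p.Prime := ⟨hprime⟩
  have hge := hω.finrank_ge hp
  obtain ⟨c, hc, hsurj, -⟩ := hω
  have htop : Algebra.adjoin F (Set.range ω) = ⊤ := by
    rw [Algebra.adjoin_range_eq_range_aeval, AlgHom.range_eq_top]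
    exact hsurj
  have hrank : finrank F (Algebra.adjoin F (Set.range ω)) = p ^ r := by
    apply le_antisymm (finite_and_finrank_adjoin_range_le hp ω c hc).2
    rwa [htop, (Subalgebra.topEquiv (R := F) (A := R)).toLinearEquiv.finrank_eq]
  have H := exists_pow_eq_algebraMap (p := p) hc htop
  obtain ⟨k, rfl⟩ : ∃ k, r = k + 1 := ⟨r - 1, by omega⟩
  obtain ⟨a, b, -, -, ha, hb, hab⟩ := exists_adjoin_range_inf_eq_bot hprime.two_le H ω hrank
  exact ⟨_, _, exists_isPBasis_adjoin hp H a ha, exists_isPBasis_adjoin hp H b hb, hab⟩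
end

section
/- Let F be a field of characteristic p > 0, let R be a finite-dimensional commutative F-algebra admitting a p-basis of length r, and let 0 ≤ s ≤ r. Then inside the ring of dual numbers R[ε] there exist an F-subalgebra L admitting a p-basis of length s and an L-submodule H of the ideal R·ε (with L acting by multiplication in R[ε]) such that: (i) the projection π : R[ε] → R is injective on L; (ii) the quotient (R·ε)/H is a free L-module of rank one; and (iii) the F-subalgebra Λ = L + H satisfies Λ ∩ (R·1) = F·1 inside R[ε]. -/
open scoped DualNumber

open Polynomial in
/-- The derivation of `A[X]` acting as `D` on the coefficients and sending `X` to `N`. -/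
noncomputable def Derivation.polynomialExtension {F A : Type*} [CommRing F] [CommRing A]
    [Algebra F A] (D : Derivation F A A) (N : A) : Derivation F A[X] A[X] :=
  PolynomialModule.equivPolynomialSelf.compDer D.mapCoeffs +
    (C N • (derivative' : Derivation A A[X] A[X])).restrictScalars F

open Polynomial in
theorem Derivation.coeff_polynomialExtension {F A : Type*} [CommRing F] [CommRing A]
    [Algebra F A] (D : Derivation F A A) (N : A) (q : A[X]) (i : ℕ) :
    (D.polynomialExtension N q).coeff i = D (q.coeff i) + N * (q.coeff (i + 1) * (i + 1)) := by
  have h : (D.polynomialExtension N q) =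
      PolynomialModule.equivPolynomialSelf (D.mapCoeffs q) + C N * derivative q := rfl
  rw [h, coeff_add, coeff_C_mul, coeff_derivative]
  rfl

open Polynomial in
/-- A derivation with constants `F` on a finite-dimensional algebra extends to one with
constants `F` after adjoining a `p`-th root of an element of `F`. -/
theorem exists_derivation_adjoinRoot {F A : Type*} [Field F] [CommRing A] [Algebra F A]
    [FiniteDimensional F A] [Nontrivial A] {p : ℕ} (hp : 0 < p) [CharP F p] (c : F)
    (D : Derivation F A A) (hD : ∀ a, D a = 0 → a ∈ Set.range (algebraMap F A)) :
    ∃ D' : Derivation F (AdjoinRoot (X ^ p - C (algebraMap F A c)))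
        (AdjoinRoot (X ^ p - C (algebraMap F A c))),
      ∀ x, D' x = 0 → x ∈ Set.range (algebraMap F _) := by
  have : CharP A p := charP_of_injective_algebraMap (algebraMap F A).injective p
  obtain ⟨N, hN⟩ : ∃ N, ∀ a, D a ≠ N := by
    by_contra! h
    have hinj := (LinearMap.injective_iff_surjective (f := D.toLinearMap)).mpr h
    exact one_ne_zero (hinj (a₁ := 1) (a₂ := 0) (by simp))
  set g : A[X] := X ^ p - C (algebraMap F A c) with hg
  have hgm : g.Monic := monic_X_pow_sub_C _ hp.ne'
  have hgd : g.degree = p := degree_X_pow_sub_C hp _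
  set E := D.polynomialExtension N with hE
  have hEg : E g = 0 := by
    ext i
    rw [hE, D.coeff_polynomialExtension, coeff_zero]
    have h1 : D (g.coeff i) = 0 := by
      simp only [hg, coeff_sub, coeff_X_pow, coeff_C]
      split_ifs <;> simp
    have h2 : g.coeff (i + 1) * ((i : A) + 1) = 0 := by
      simp only [hg, coeff_sub, coeff_X_pow, coeff_C_succ, sub_zero]
      split_ifs with h
      · rw [one_mul, ← Nat.cast_succ, Nat.succ_eq_add_one, h, CharP.cast_eq_zero]
      · simp
    rw [h1, h2]; simp
  have hker : ∀ x, (AdjoinRoot.mkₐ g).restrictScalars F x = 0 →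
      (AdjoinRoot.mkₐ g).restrictScalars F (E x) = 0 := by
    intro x hx
    rw [AlgHom.restrictScalars_apply, AdjoinRoot.coe_mkₐ, AdjoinRoot.mk_eq_zero] at hx ⊢
    obtain ⟨y, rfl⟩ := hx
    rw [Derivation.leibniz, hEg, smul_zero, add_zero]
    exact dvd_mul_right _ _
  refine ⟨Derivation.liftOfSurjective (f := (AdjoinRoot.mkₐ g).restrictScalars F)
    AdjoinRoot.mk_surjective hker, fun x hx => ?_⟩
  obtain ⟨q₀, rfl⟩ := AdjoinRoot.mk_surjective x
  obtain ⟨q, hq, hqd⟩ : ∃ q, AdjoinRoot.mk g q₀ = AdjoinRoot.mk g q ∧ q.degree < p := by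
    refine ⟨q₀ %ₘ g, ?_, hgd ▸ degree_modByMonic_lt _ hgm⟩
    rw [AdjoinRoot.mk_eq_mk]
    exact ⟨q₀ /ₘ g, sub_eq_of_eq_add' (modByMonic_add_div q₀ g).symm⟩
  rw [hq] at hx ⊢
  have hx' : AdjoinRoot.mk g (E q) = 0 := by
    rw [← hx]
    exact (Derivation.liftOfSurjective_apply
      (f := (AdjoinRoot.mkₐ g).restrictScalars F) AdjoinRoot.mk_surjective hker q).symm
  have hEq : E q = 0 := by
    by_contra h
    refine AdjoinRoot.mk_ne_zero_of_degree_lt hgm h ?_ hx'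
    rw [hgd, degree_lt_iff_coeff_zero]
    intro m hm
    have hz := (degree_lt_iff_coeff_zero q p).mp hqd
    rw [hE, D.coeff_polynomialExtension, hz m hm, hz (m + 1) (by lia)]
    simp
  have hcoeff : ∀ i, D (q.coeff i) + N * (q.coeff (i + 1) * (i + 1)) = 0 := fun i => by
    rw [← D.coeff_polynomialExtension, ← hE, hEq, coeff_zero]
  have hdeg : q.natDegree = 0 := by
    by_contra hne
    obtain ⟨m, hm⟩ := Nat.exists_eq_succ_of_ne_zero hne
    have hq0 : q ≠ 0 := by rintro rfl; simp at hne
    have hmp : m + 1 < p := by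
      have := (natDegree_lt_iff_degree_lt hq0).mpr hqd
      lia
    have htop := hcoeff (m + 1)
    rw [coeff_eq_zero_of_natDegree_lt (n := m + 1 + 1) (by lia), zero_mul, mul_zero,
      add_zero] at htop
    obtain ⟨u, hu⟩ := hD _ htop
    have hu0 : u ≠ 0 := by
      rintro rfl
      rw [map_zero, eq_comm, ← Nat.succ_eq_add_one, ← hm] at hu
      exact hq0 (leadingCoeff_eq_zero.mp hu)
    have hm0 : ((m + 1 : ℕ) : F) ≠ 0 := by
      rw [Ne, CharP.cast_eq_zero_iff F p]
      exact fun h => absurd (Nat.le_of_dvd (by lia) h) (by lia)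
    have hlow := hcoeff m
    rw [← hu] at hlow
    have hlow' : D (q.coeff m) = -((u * ((m + 1 : ℕ) : F)) • N) := by
      rw [Algebra.smul_def, map_mul, map_natCast]
      push_cast
      linear_combination hlow
    apply hN (-((u * ((m + 1 : ℕ) : F))⁻¹ • q.coeff m))
    rw [map_neg, Derivation.map_smul, hlow', smul_neg, neg_neg, smul_smul,
      inv_mul_cancel₀ (mul_ne_zero hu0 hm0), one_smul]
  rw [eq_C_of_natDegree_eq_zero hdeg] at hcoeff ⊢
  obtain ⟨u, hu⟩ := hD (q.coeff 0) (by simpa using hcoeff 0)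
  exact ⟨u, by rw [← hu]; rfl⟩

/-- The algebra `F[T₁,…,Tₙ]/(T₁^p − c₁,…,Tₙ^p − cₙ)`. -/
abbrev PRootAlgebra {F : Type*} [CommRing F] (p : ℕ) {n : ℕ} (c : Fin n → F) : Type _ :=
  MvPolynomial (Fin n) F ⧸
    Ideal.span (Set.range fun i => MvPolynomial.X i ^ p - MvPolynomial.C (c i))

namespace PRootAlgebra

variable {F : Type*} [CommRing F] {p n : ℕ} {c : Fin n → F}

variable (p c) in
/-- The canonical generators. -/
noncomputable def gen (i : Fin n) : PRootAlgebra p c := Ideal.Quotient.mk _ (MvPolynomial.X i)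

theorem gen_pow (i : Fin n) : gen p c i ^ p = algebraMap F _ (c i) := by
  rw [gen, ← map_pow]
  exact Ideal.Quotient.eq.mpr (Ideal.subset_span ⟨i, rfl⟩)

/-- The homomorphism given by a tuple of `p`-th roots. -/
noncomputable def lift {A : Type*} [CommRing A] [Algebra F A] (a : Fin n → A)
    (ha : ∀ i, a i ^ p = algebraMap F A (c i)) : PRootAlgebra p c →ₐ[F] A :=
  Ideal.Quotient.liftₐ _ (MvPolynomial.aeval a) (by
    intro x hx
    suffices h : Ideal.span (Set.range fun i => MvPolynomial.X i ^ p - MvPolynomial.C (c i)) ≤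
      RingHom.ker (MvPolynomial.aeval (R := F) a) from h hx
    rw [Ideal.span_le]
    rintro _ ⟨i, rfl⟩
    simp [ha])

@[simp]
theorem lift_gen {A : Type*} [CommRing A] [Algebra F A] (a : Fin n → A)
    (ha : ∀ i, a i ^ p = algebraMap F A (c i)) (i : Fin n) : lift a ha (gen p c i) = a i :=
  MvPolynomial.aeval_X (R := F) a i

theorem hom_ext {A : Type*} [CommRing A] [Algebra F A] {f g : PRootAlgebra p c →ₐ[F] A}
    (h : ∀ i, f (gen p c i) = g (gen p c i)) : f = g :=
  Ideal.Quotient.algHom_ext F (MvPolynomial.algHom_ext h)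

theorem isPBasis_of_equiv {A : Type*} [CommRing A] [Algebra F A] (e : PRootAlgebra p c ≃ₐ[F] A) :
    IsPBasis F p fun i => e (gen p c i) := by
  have h : MvPolynomial.aeval (R := F) (fun i => e (gen p c i)) =
      e.toAlgHom.comp (Ideal.Quotient.mkₐ F _) := by
    apply MvPolynomial.algHom_ext
    intro i
    rw [MvPolynomial.aeval_X]
    rfl
  refine ⟨c, fun i => ?_, ?_, ?_⟩
  · rw [← map_pow, gen_pow, AlgEquiv.commutes]
  · rw [h]
    exact e.surjective.comp Ideal.Quotient.mk_surjective
  · rw [h]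
    ext x
    exact (EmbeddingLike.map_eq_zero_iff (f := e)).trans Ideal.Quotient.eq_zero_iff_mem

theorem nonempty_equiv_of_isPBasis {A : Type*} [CommRing A] [Algebra F A] {ω : Fin n → A}
    (hω : IsPBasis F p ω) : ∃ c : Fin n → F, Nonempty (PRootAlgebra p c ≃ₐ[F] A) := by
  obtain ⟨c, -, hsurj, hker⟩ := hω
  exact ⟨c, ⟨(Ideal.quotientEquivAlgOfEq F hker.symm).trans
    (Ideal.quotientKerAlgEquivOfSurjective hsurj)⟩⟩

/-- The homomorphism induced by omitting the last generator. -/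
noncomputable def initHom (p : ℕ) {n : ℕ} (c : Fin (n + 1) → F) :
    PRootAlgebra p (Fin.init c) →ₐ[F] PRootAlgebra p c :=
  lift (fun i => gen p c i.castSucc) fun i => gen_pow i.castSucc

@[simp]
theorem initHom_gen (p : ℕ) {n : ℕ} (c : Fin (n + 1) → F) (i : Fin n) :
    initHom p c (gen p (Fin.init c) i) = gen p c i.castSucc :=
  lift_gen (c := Fin.init c) _ _ i

open Polynomial in
/-- Adjoining one more root to `PRootAlgebra`. -/
noncomputable def succEquiv (p : ℕ) {n : ℕ} (c : Fin (n + 1) → F) :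
    PRootAlgebra p c ≃ₐ[F] AdjoinRoot
      (X ^ p - C (algebraMap F (PRootAlgebra p (Fin.init c)) (c (Fin.last n)))) :=
  AlgEquiv.ofAlgHom
    (lift (Fin.snoc (α := fun _ => AdjoinRoot
        (X ^ p - C (algebraMap F (PRootAlgebra p (Fin.init c)) (c (Fin.last n)))))
      (fun i => AdjoinRoot.of _ (gen p (Fin.init c) i)) (AdjoinRoot.root _)) (by
        intro i
        refine Fin.lastCases ?_ (fun i => ?_) i
        · rw [Fin.snoc_last, ← sub_eq_zero]
          have := AdjoinRoot.eval₂_root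
            (X ^ p - C (algebraMap F (PRootAlgebra p (Fin.init c)) (c (Fin.last n))))
          rw [eval₂_sub, eval₂_X_pow, eval₂_C] at this
          exact this
        · rw [Fin.snoc_castSucc, ← map_pow, gen_pow]
          rfl))
    (AdjoinRoot.liftAlgHom _
      (initHom p c)
      (gen p c (Fin.last n)) (by
        rw [eval₂_sub, eval₂_X_pow, eval₂_C, gen_pow]
        exact sub_eq_zero.mpr ((initHom p c).commutes _).symm))
    (by
      apply AdjoinRoot.algHom_ext'
      · apply hom_ext
        intro i
        simp
      · simp)
    (by
      apply hom_ext
      intro i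
      refine Fin.lastCases ?_ (fun i => ?_) i <;> simp)

theorem nontrivial_and_finite_and_exists_derivation {F : Type*} [Field F] {p : ℕ} (hp : 0 < p)
    [CharP F p] {n : ℕ} (c : Fin n → F) :
    Nontrivial (PRootAlgebra p c) ∧ FiniteDimensional F (PRootAlgebra p c) ∧
      ∃ D : Derivation F (PRootAlgebra p c) (PRootAlgebra p c),
        ∀ a, D a = 0 → a ∈ Set.range (algebraMap F (PRootAlgebra p c)) := by
  induction n with
  | zero =>
    have hsurj : Function.Surjective (algebraMap F (PRootAlgebra p c)) :=
      Ideal.Quotient.mk_surjective.comp (MvPolynomial.C_surjective (Fin 0))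
    exact ⟨(lift (A := F) (c := c) Fin.elim0 fun i => i.elim0).toRingHom.domain_nontrivial,
      Module.Finite.of_surjective (Algebra.linearMap F _) hsurj, 0, fun a _ => hsurj a⟩
  | succ n ih =>
    obtain ⟨h1, h2, D, hD⟩ := ih (Fin.init c)
    have e := succEquiv p c
    have hgm := Polynomial.monic_X_pow_sub_C
      (algebraMap F (PRootAlgebra p (Fin.init c)) (c (Fin.last n))) hp.ne'
    have hfin := hgm.finite_adjoinRoot
    have hfin' := Module.Finite.trans (R := F) (PRootAlgebra p (Fin.init c)) (AdjoinRoot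
      (Polynomial.X ^ p -
        Polynomial.C (algebraMap F (PRootAlgebra p (Fin.init c)) (c (Fin.last n)))))
    obtain ⟨D', hD'⟩ := exists_derivation_adjoinRoot hp (c (Fin.last n)) D hD
    refine ⟨?_, Module.Finite.equiv e.symm.toLinearEquiv,
      Derivation.liftOfSurjective (f := e.symm) (d := D') e.symm.surjective fun x hx => ?_,
      fun a ha => ?_⟩
    · rw [e.toEquiv.nontrivial_congr]
      refine ⟨1, 0, fun h => ?_⟩
      rw [← map_one (AdjoinRoot.mk _)] at h
      refine AdjoinRoot.mk_ne_zero_of_degree_lt hgm one_ne_zero ?_ h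
      rw [Polynomial.degree_X_pow_sub_C hp, Polynomial.degree_one]
      exact_mod_cast hp
    · rw [(EmbeddingLike.map_eq_zero_iff (f := e.symm)).mp hx, map_zero, map_zero]
    · obtain ⟨b, rfl⟩ := e.symm.surjective a
      rw [Derivation.liftOfSurjective_apply, EmbeddingLike.map_eq_zero_iff] at ha
      obtain ⟨u, rfl⟩ := hD' b ha
      exact ⟨u, (e.symm.commutes u).symm⟩

theorem exists_algHom_retraction {F : Type*} [Field F] {p : ℕ} (hp : 0 < p) [CharP F p]
    {s r : ℕ} (hs : s ≤ r) (c : Fin r → F) :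
    ∃ (c' : Fin s → F) (i : PRootAlgebra p c' →ₐ[F] PRootAlgebra p c)
      (φ : PRootAlgebra p c →ₗ[F] PRootAlgebra p c'),
      (∀ a x, φ (i a * x) = a * φ x) ∧ φ 1 = 1 := by
  induction r, hs using Nat.le_induction with
  | base => exact ⟨c, AlgHom.id F _, LinearMap.id, fun _ _ => rfl, rfl⟩
  | succ n hn ih =>
    obtain ⟨c', i, φ, hφ, hφ1⟩ := ih (Fin.init c)
    have e := succEquiv p c
    have := (nontrivial_and_finite_and_exists_derivation hp (Fin.init c)).1
    have hgm := Polynomial.monic_X_pow_sub_C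
      (algebraMap F (PRootAlgebra p (Fin.init c)) (c (Fin.last n))) hp.ne'
    let ψ := Polynomial.lcoeff (PRootAlgebra p (Fin.init c)) 0 ∘ₗ AdjoinRoot.modByMonicHom hgm
    have hψ1 : ψ 1 = 1 := by
      rw [← map_one (AdjoinRoot.mk _)]
      simp only [ψ, LinearMap.comp_apply, AdjoinRoot.modByMonicHom_mk]
      rw [(Polynomial.modByMonic_eq_self_iff hgm).mpr]
      · simp
      · rw [Polynomial.degree_X_pow_sub_C hp, Polynomial.degree_one]
        exact_mod_cast hp
    refine ⟨c', e.symm.toAlgHom.comp ((AdjoinRoot.ofAlgHom F _).comp i),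
      φ ∘ₗ ψ.restrictScalars F ∘ₗ e.toLinearMap, fun a x => ?_, ?_⟩
    · have h : e (e.symm (AdjoinRoot.of _ (i a)) * x) = i a • e x := by
        rw [map_mul, AlgEquiv.apply_symm_apply]
        exact (Algebra.smul_def (i a) (e x)).symm
      change φ (ψ (e (e.symm (AdjoinRoot.of _ (i a)) * x))) = a * φ (ψ (e x))
      rw [h, map_smul, smul_eq_mul, hφ]
    · change φ (ψ (e 1)) = 1
      rw [map_one, hψ1, hφ1]

end PRootAlgebra

/-- The homomorphism `a ↦ i a + i (D a) ε` into the dual numbers. -/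
def Derivation.toDualNumber {F A R : Type*} [CommRing F] [CommRing A] [CommRing R] [Algebra F A]
    [Algebra F R] (D : Derivation F A A) (i : A →ₐ[F] R) : A →ₐ[F] DualNumber R where
  toFun a := TrivSqZeroExt.inl (i a) + TrivSqZeroExt.inr (i (D a))
  map_one' := by ext <;> simp
  map_zero' := by ext <;> simp
  map_add' a b := by ext <;> simp
  map_mul' a b := by ext <;> simp [mul_comm]
  commutes' u := by
    rw [i.commutes, D.map_algebraMap, map_zero, TrivSqZeroExt.inr_zero, add_zero]
    rfl

/-- Existence of subalgebras `Λ = L + H·ε` of the ring of dual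
numbers `R[ε]` with the stated properties. -/
theorem statement1 (F R : Type*) [Field F] [CommRing R] [Algebra F R]
    [FiniteDimensional F R] (p : ℕ) (hp : 0 < p) [CharP F p]
    (r s : ℕ) (hs : s ≤ r) (ω : Fin r → R) (hω : IsPBasis F p ω) :
    ∃ (L : Subalgebra F (DualNumber R)) (H : Submodule F (DualNumber R)),
      -- `H` is contained in the ideal `R·ε` ...
      (∀ x ∈ H, TrivSqZeroExt.fst x = 0) ∧
      -- ... and is an `L`-submodule (stable under multiplication by `L`):
      (∀ l ∈ L, ∀ x ∈ H, l * x ∈ H) ∧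
      -- `L` admits a `p`-basis of length `s`:
      (∃ ωL : Fin s → L, IsPBasis F p ωL) ∧
      -- (i) the projection `π : R[ε] → R` is injective on `L`:
      Set.InjOn (TrivSqZeroExt.fst) (L : Set (DualNumber R)) ∧
      -- (ii) the quotient `(R·ε)/H` is a free `L`-module of rank one:
      (∃ e : DualNumber R, TrivSqZeroExt.fst e = 0 ∧
        (∀ x : DualNumber R, TrivSqZeroExt.fst x = 0 →
          ∃ l ∈ L, ∃ h ∈ H, x = l * e + h) ∧
        (∀ l ∈ L, l * e ∈ H → l = 0)) ∧
      -- (iii) `Λ = L + H` satisfies `Λ ∩ (R·1) = F·1` inside `R[ε]`: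
      {x : DualNumber R | ∃ l ∈ L, ∃ h ∈ H, x = l + h} ∩
          Set.range (TrivSqZeroExt.inl : R → DualNumber R) =
        Set.range (algebraMap F (DualNumber R)) := by
  obtain ⟨c, ⟨e⟩⟩ := PRootAlgebra.nonempty_equiv_of_isPBasis hω
  obtain ⟨c', j, ψ, hψ, hψ1⟩ := PRootAlgebra.exists_algHom_retraction hp hs c
  obtain ⟨-, -, D, hD⟩ := PRootAlgebra.nontrivial_and_finite_and_exists_derivation hp c'
  let i : PRootAlgebra p c' →ₐ[F] R := e.toAlgHom.comp j
  let φ : R →ₗ[F] PRootAlgebra p c' := ψ ∘ₗ e.symm.toLinearMap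
  have hφ : ∀ a x, φ (i a * x) = a * φ x := fun a x => by
    change ψ (e.symm (e (j a) * x)) = a * ψ (e.symm x)
    rw [map_mul, AlgEquiv.symm_apply_apply, hψ]
  have hφ1 : φ 1 = 1 := by
    change ψ (e.symm 1) = 1
    rw [map_one, hψ1]
  have hφi : ∀ a, φ (i a) = a := fun a => by
    rw [← mul_one (i a), hφ, hφ1, mul_one]
  let δ := D.toDualNumber i
  have hfst : ∀ a, (δ a).fst = i a := fun a => by simp [δ, Derivation.toDualNumber]
  have hsnd : ∀ a, (δ a).snd = i (D a) := fun a => by simp [δ, Derivation.toDualNumber]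
  have hδ : Function.Injective δ := fun a b hab => by
    rw [← hφi a, ← hφi b, ← hfst, ← hfst, hab]
  refine ⟨δ.range, (LinearMap.ker φ).map (TrivSqZeroExt.inrHom R R |>.restrictScalars F),
    ?_, ?_, ⟨_, PRootAlgebra.isPBasis_of_equiv (AlgEquiv.ofInjective δ hδ)⟩, ?_,
    ⟨TrivSqZeroExt.inr 1, rfl, ?_, ?_⟩, ?_⟩
  · rintro _ ⟨h, -, rfl⟩
    rfl
  · rintro _ ⟨a, rfl⟩ _ ⟨h, hh, rfl⟩
    refine ⟨i a * h, ?_, ?_⟩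
    · rw [SetLike.mem_coe, LinearMap.mem_ker] at hh ⊢
      rw [hφ, hh, mul_zero]
    · ext
      · simp
      · simp [← hfst, mul_comm]
  · rintro _ ⟨a, rfl⟩ _ ⟨b, rfl⟩ hab
    have hab' : i a = i b := by rw [← hfst, ← hfst]; exact hab
    change δ a = δ b
    rw [← hφi a, hab', hφi]
  · intro x hx
    refine ⟨δ (φ x.snd), ⟨_, rfl⟩, TrivSqZeroExt.inr (x.snd - i (φ x.snd)), ⟨_, ?_, rfl⟩, ?_⟩
    · rw [SetLike.mem_coe, LinearMap.mem_ker, map_sub, hφi, sub_self]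
    · ext
      · simp [hx]
      · simp [hfst]
  · rintro _ ⟨a, rfl⟩ ⟨h, hh, heq⟩
    have h1 : h = i a := by
      have := congrArg TrivSqZeroExt.snd heq
      simpa [hfst] using this
    rw [SetLike.mem_coe, LinearMap.mem_ker, h1, hφi] at hh
    rw [hh]
    exact map_zero δ
  · ext x
    constructor
    · rintro ⟨⟨_, ⟨a, rfl⟩, _, ⟨h, hh, rfl⟩, rfl⟩, y, hy⟩
      have h1 : i (D a) + h = 0 := by
        have := congrArg TrivSqZeroExt.snd hy
        simpa [hsnd] using this.symm
      rw [SetLike.mem_coe, LinearMap.mem_ker] at hh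
      have h2 : D a = 0 := by
        rw [← hφi (D a), eq_neg_of_add_eq_zero_left h1, map_neg, hh, neg_zero]
      rw [h2, map_zero, zero_add] at h1
      obtain ⟨u, rfl⟩ := hD a h2
      refine ⟨u, ?_⟩
      rw [h1, map_zero, add_zero]
      exact (δ.commutes u).symm
    · rintro ⟨u, rfl⟩
      exact ⟨⟨_, δ.range.algebraMap_mem u, 0, Submodule.zero_mem _, (add_zero _).symm⟩,
        algebraMap F R u, rfl⟩
end

section
/- Let F ⊆ E be fields with [E:F] finite, and let Λ ⊆ E[ε] be an F-subalgebra which is a local ring whose maximal ideal equals Λ ∩ E·ε, and such that dim_F E[ε] = 2·dim_F Λ. Then there exists a subfield L ⊆ Λ such that Λ = L ⊕ (Λ ∩ E·ε) as F-vector spaces, and, setting Hε := Λ ∩ E·ε (an L-submodule of E·ε via multiplication in E[ε]), the quotient (E·ε)/Hε is a one-dimensional L-vector space; in other words Λ = L + Hε with L a subfield of E[ε] and Hε an L-hyperplane in E·ε. -/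
open scoped DualNumber
open TrivSqZeroExt

namespace DualNumber

section Derivation

variable {F K E : Type*} [Field F] [Field K] [Field E] [Algebra F K] [Algebra F E] [Algebra K E]
  [IsScalarTower F K E]

/-- A derivation of a field extension into a quotient lifts along the quotient map. -/
theorem exists_derivation_lift (H : Submodule K E) (D : Derivation F K (E ⧸ H)) :
    ∃ D' : Derivation F K E, ∀ x, H.mkQ (D' x) = D x := by
  obtain ⟨g, hg⟩ := Module.projective_lifting_property H.mkQ D.liftKaehlerDifferential
    H.mkQ_surjective
  refine ⟨g.compDer (KaehlerDifferential.D F K), fun x => ?_⟩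
  have := LinearMap.congr_fun hg (KaehlerDifferential.D F K x)
  simpa using this

/-- The algebra homomorphism `x ↦ x + D x ε` attached to a derivation `D`. -/
def algHomOfDerivation (D : Derivation F K E) : K →ₐ[F] DualNumber E :=
  AlgHom.ofLinearMap
    ((inlAlgHom F E E).toLinearMap ∘ₗ (IsScalarTower.toAlgHom F K E).toLinearMap +
      (inrHom E E).restrictScalars F ∘ₗ D.toLinearMap)
    (by ext <;> simp)
    (fun x y => by
      ext
      · simp
      · simp [Algebra.smul_def, -inr_eq_smul_eps, mul_comm])

@[simp]
theorem fst_algHomOfDerivation (D : Derivation F K E) (x : K) :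
    fst (algHomOfDerivation D x) = algebraMap K E x := by
  simp [algHomOfDerivation]

@[simp]
theorem snd_algHomOfDerivation (D : Derivation F K E) (x : K) :
    snd (algHomOfDerivation D x) = D x := by
  simp [algHomOfDerivation]

end Derivation

variable {F E : Type*} [Field F] [Field E] [Algebra F E] [FiniteDimensional F E]
  (Λ : Subalgebra F (DualNumber E))

/-- The image of a subalgebra of `E[ε]` under `ε ↦ 0`, as an intermediate field. -/
def residueField : IntermediateField F E :=
  (Λ.map (fstHom F E E)).toIntermediateField fun _ hx =>
    Subalgebra.inv_mem_of_algebraic (Λ.map (fstHom F E E)) (x := ⟨_, hx⟩)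
      (Algebra.IsAlgebraic.isAlgebraic _)

variable {Λ} in
theorem mem_residueField {x : E} : x ∈ residueField Λ ↔ ∃ y ∈ Λ, fst y = x := Iff.rfl

/-- The coefficients `h` such that `h ε` lies in `Λ`. -/
def infinitesimalPart : Submodule (residueField Λ) E where
  carrier := {h | (inr h : DualNumber E) ∈ Λ}
  add_mem' {a b} ha hb := by
    simpa [-inr_eq_smul_eps] using Λ.add_mem ha hb
  zero_mem' := by simp
  smul_mem' c h hh := by
    obtain ⟨y, hy, hyc⟩ := mem_residueField.1 c.2
    have := Λ.mul_mem hy hh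
    have e : y * inr h = (inr (c • h) : DualNumber E) := by
      ext <;> simp [hyc, Algebra.smul_def, -inr_eq_smul_eps]
    rwa [e] at this

variable {Λ} in
theorem mem_infinitesimalPart {h : E} :
    h ∈ infinitesimalPart Λ ↔ (inr h : DualNumber E) ∈ Λ := Iff.rfl

variable {Λ} in
theorem snd_sub_snd_mem_infinitesimalPart {x y : DualNumber E} (hx : x ∈ Λ) (hy : y ∈ Λ)
    (h : fst x = fst y) : snd x - snd y ∈ infinitesimalPart Λ := by
  have e : x - y = inr (snd x - snd y) := by
    ext <;> simp [h]
  rw [mem_infinitesimalPart, ← e]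
  exact Λ.sub_mem hx hy

/-- The derivation sending `fst x` to the class of `snd x`, for `x` in `Λ`. -/
theorem exists_derivation_residueField :
    ∃ D : Derivation F (residueField Λ) (E ⧸ infinitesimalPart Λ),
      ∀ x (hx : x ∈ Λ), D ⟨fst x, x, hx, rfl⟩ = (infinitesimalPart Λ).mkQ (snd x) := by
  choose s hs hsf using fun k : residueField Λ => mem_residueField.1 k.2
  have key : ∀ k : residueField Λ, ∀ x ∈ Λ, fst x = (k : E) →
      (infinitesimalPart Λ).mkQ (snd (s k)) = (infinitesimalPart Λ).mkQ (snd x) :=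
    fun k x hx hxk => (Submodule.Quotient.eq _).2
      (snd_sub_snd_mem_infinitesimalPart (hs k) hx ((hsf k).trans hxk.symm))
  let f : residueField Λ →ₗ[F] E ⧸ infinitesimalPart Λ :=
    { toFun k := (infinitesimalPart Λ).mkQ (snd (s k))
      map_add' a b := by
        rw [key (a + b) (s a + s b) (Λ.add_mem (hs a) (hs b)) (by simp [hsf])]
        simp
      map_smul' c a := by
        rw [key (c • a) (c • s a) (Λ.smul_mem (hs a) c) (by simp [hsf])]
        simp }
  refine ⟨Derivation.mk' f fun a b => ?_, fun x hx => key _ x hx rfl⟩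
  change (infinitesimalPart Λ).mkQ _ = a • (infinitesimalPart Λ).mkQ _ +
    b • (infinitesimalPart Λ).mkQ _
  rw [key (a * b) (s a * s b) (Λ.mul_mem (hs a) (hs b)) (by simp [hsf]),
    ← map_smul, ← map_smul, ← map_add]
  congr 1
  simp [hsf, Algebra.smul_def, mul_comm]

theorem finrank_eq_add :
    Module.finrank F Λ =
      Module.finrank F (residueField Λ) + Module.finrank F (infinitesimalPart Λ) := by
  have : FiniteDimensional F (DualNumber E) := inferInstanceAs (FiniteDimensional F (E × E))
  let p : Λ →ₗ[F] E := ((fstHom F E E).comp Λ.val).toLinearMap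
  have hr : LinearMap.range p = Subalgebra.toSubmodule (residueField Λ).toSubalgebra := by
    ext x
    constructor
    · rintro ⟨y, rfl⟩
      exact ⟨y, y.2, rfl⟩
    · rintro ⟨y, hy, rfl⟩
      exact ⟨⟨y, hy⟩, rfl⟩
  let e : LinearMap.ker p ≃ₗ[F] infinitesimalPart Λ :=
    { toFun x := ⟨snd (x : DualNumber E), by
        have h0 : fst (x : DualNumber E) = 0 := x.2
        simpa using snd_sub_snd_mem_infinitesimalPart x.1.2 Λ.zero_mem (by simp [h0])⟩
      invFun h := ⟨⟨inr h, h.2⟩, by simp [p]⟩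
      map_add' _ _ := rfl
      map_smul' _ _ := rfl
      left_inv x := by
        have h0 : fst (x : DualNumber E) = 0 := x.2
        ext <;> simp [h0]
      right_inv _ := by simp }
  rw [← LinearMap.finrank_range_add_finrank_ker p, hr, e.finrank_eq]
  rfl

theorem finrank_quotient_infinitesimalPart
    (hdim : Module.finrank F (DualNumber E) = 2 * Module.finrank F Λ) :
    Module.finrank (residueField Λ) (E ⧸ infinitesimalPart Λ) = 1 := by
  have h2 : Module.finrank F (DualNumber E) = Module.finrank F E + Module.finrank F E :=
    Module.finrank_prod (R := F) (M := E) (M' := E)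
  have hE := Module.finrank_mul_finrank F (residueField Λ) E
  have hH := Module.finrank_mul_finrank F (residueField Λ) (infinitesimalPart Λ)
  have hq := (infinitesimalPart Λ).finrank_quotient_add_finrank
  have hpos : 0 < Module.finrank F (residueField Λ) := Module.finrank_pos
  have hs := finrank_eq_add Λ
  rw [← hq] at hE
  apply Nat.eq_of_mul_eq_mul_left hpos
  rw [mul_add] at hE
  lia

end DualNumber

open DualNumber

/-- If `Λ ⊆ E[ε]` is an `F`-subalgebra which is local with
maximal ideal `Λ ∩ E·ε` and `dim_F E[ε] = 2 dim_F Λ`, then `Λ = L ⊕ (Λ ∩ E·ε)`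
for a subfield `L`, and `(E·ε)/(Λ ∩ E·ε)` is a one-dimensional `L`-vector
space. -/
theorem statement2 (F E : Type*) [Field F] [Field E] [Algebra F E]
    [FiniteDimensional F E] (Λ : Subalgebra F (DualNumber E))
    [IsLocalRing Λ]
    (hmax : ∀ x : Λ, x ∈ IsLocalRing.maximalIdeal Λ ↔
      TrivSqZeroExt.fst (x : DualNumber E) = 0)
    (hdim : Module.finrank F (DualNumber E) = 2 * Module.finrank F Λ) :
    ∃ L : Subalgebra F (DualNumber E), L ≤ Λ ∧ IsField L ∧
      -- `Λ = L ⊕ (Λ ∩ E·ε)` as `F`-vector spaces: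
      (∀ x ∈ Λ, ∃ l ∈ L, ∃ h, (h ∈ Λ ∧ TrivSqZeroExt.fst h = 0) ∧ x = l + h) ∧
      (∀ l ∈ L, TrivSqZeroExt.fst l = 0 → l = 0) ∧
      -- `(E·ε)/Hε` is one-dimensional over `L`, where `Hε = Λ ∩ E·ε`:
      (∃ e : DualNumber E, TrivSqZeroExt.fst e = 0 ∧ e ∉ Λ ∧
        ∀ x : DualNumber E, TrivSqZeroExt.fst x = 0 →
          ∃ l ∈ L, ∃ h, (h ∈ Λ ∧ TrivSqZeroExt.fst h = 0) ∧ x = l * e + h) := by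
  obtain ⟨D₀, hD₀⟩ := exists_derivation_residueField Λ
  obtain ⟨D, hD⟩ := exists_derivation_lift _ D₀
  have hinj : Function.Injective (algHomOfDerivation D) :=
    (algHomOfDerivation D).toRingHom.injective
  have hmem : ∀ k, algHomOfDerivation D k ∈ Λ := by
    rintro ⟨-, x, hx, rfl⟩
    have h : D ⟨fst x, x, hx, rfl⟩ - snd x ∈ infinitesimalPart Λ :=
      (Submodule.Quotient.eq _).1 ((hD _).trans (hD₀ x hx))
    convert Λ.add_mem hx (mem_infinitesimalPart.1 h) using 1
    ext <;> simp
  obtain ⟨v, hv, hspan⟩ := finrank_eq_one_iff'.1 (finrank_quotient_infinitesimalPart Λ hdim)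
  obtain ⟨e, rfl⟩ := (infinitesimalPart Λ).mkQ_surjective v
  refine ⟨(algHomOfDerivation D).range, ?_, ?_, ?_, ?_, inr e, fst_inr _ _, ?_, ?_⟩
  · rintro _ ⟨k, rfl⟩
    exact hmem k
  · exact (AlgEquiv.ofInjective _ hinj).symm.toMulEquiv.isField (Field.toIsField _)
  · intro x hx
    let k : residueField Λ := ⟨fst x, x, hx, rfl⟩
    exact ⟨algHomOfDerivation D k, ⟨k, rfl⟩, x - algHomOfDerivation D k,
      ⟨Λ.sub_mem hx (hmem k), by simp [k]⟩, by simp⟩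
  · rintro _ ⟨k, rfl⟩ hk
    have : k = 0 := by simpa using hk
    simp [this]
  · exact fun he => hv ((Submodule.Quotient.mk_eq_zero _).2 he)
  · intro x hx
    obtain ⟨c, hc⟩ := hspan ((infinitesimalPart Λ).mkQ (snd x))
    have h : snd x - c • e ∈ infinitesimalPart Λ := (Submodule.Quotient.eq _).1 hc.symm
    refine ⟨algHomOfDerivation D c, ⟨c, rfl⟩, inr (snd x - c • e), ⟨h, fst_inr _ _⟩, ?_⟩
    ext
    · simp [hx]
    · simp [Algebra.smul_def, -inr_eq_smul_eps]
end

section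
/- Let F ⊆ E be fields of characteristic 2 such that E admits a p-basis ω₁,…,ω_r over F, with dual derivations ∂₁,…,∂_r. Let D be an F-linear derivation of the Laurent polynomial ring E[u,u⁻¹] satisfying D(u) = u⁻² + 1 and D(λ) = (u⁻² + u⁻¹)·Σᵢ₌₁^r ωᵢ·∂ᵢ(λ) for all λ ∈ E. Then D∘D = 0, D(u³) = 1 + u², and D(ωₖ + ωₖ·u) = 0 for all 1 ≤ k ≤ r. -/
open LaurentPolynomial

namespace Derivation

variable {F A : Type*} [CommRing F] [CommRing A] [Algebra F A]

theorem comp_self_mul_of_charTwo [CharP A 2] (D : Derivation F A A) (a b : A) :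
    D (D (a * b)) = a * D (D b) + b * D (D a) := by
  simp only [leibniz, map_add, smul_eq_mul]
  linear_combination (D a * D b) * CharTwo.two_eq_zero (R := A)

/-- In characteristic two the square of a derivation is a derivation, so its kernel is a
subalgebra. -/
def kerCompSelf [CharP A 2] (D : Derivation F A A) : Subalgebra F A where
  carrier := {a | D (D a) = 0}
  mul_mem' {a b} ha hb := by
    simp only [Set.mem_ofPred_eq] at *
    rw [comp_self_mul_of_charTwo, ha, hb]
    simp
  add_mem' {a b} ha hb := by
    simp only [Set.mem_ofPred_eq] at *
    simp [ha, hb]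
  algebraMap_mem' c := by simp

theorem mem_kerCompSelf [CharP A 2] {D : Derivation F A A} {a : A} :
    a ∈ D.kerCompSelf ↔ D (D a) = 0 := Iff.rfl

end Derivation

theorem statement6 (F E : Type*) [Field F] [Field E] [Algebra F E] [CharP F 2]
    (r : ℕ) (ω : Fin r → E) (hω : IsPBasis F 2 ω)
    (der : Fin r → Derivation F E E)
    (hder : ∀ i j, der i (ω j) = if i = j then (1 : E) else 0)
    (D : Derivation F (LaurentPolynomial E) (LaurentPolynomial E))
    (hDu : D (T 1) = T (-2) + 1)
    (hDC : ∀ lam : E, D (C lam) =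
      (T (-2) + T (-1)) * ∑ i, C (ω i * der i lam)) :
    (∀ f, D (D f) = 0) ∧
    D (T 3) = 1 + T 2 ∧
    ∀ k, D (C (ω k) + C (ω k) * T 1) = 0 := by
  have : CharP E[T;T⁻¹] 2 := charP_of_injective_algebraMap (algebraMap F E[T;T⁻¹]).injective 2
  have two : (2 : E[T;T⁻¹]) = 0 := CharTwo.two_eq_zero
  have hm2 : (T (-2) : E[T;T⁻¹]) = T (-1) ^ 2 := by rw [T_pow]; norm_num
  have hTT : (T 1 * T (-1) : E[T;T⁻¹]) = 1 := by rw [← T_add]; simp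
  have hDsq (f : E[T;T⁻¹]) : D (f ^ 2) = 0 := by
    rw [sq, D.leibniz, smul_eq_mul]
    linear_combination (f * D f) * two
  have hDinv : D (T (-1)) = T (-1) ^ 4 + T (-1) ^ 2 := by
    have h := congrArg D hTT
    rw [D.leibniz, D.map_one_eq_zero, hDu, hm2, smul_eq_mul, smul_eq_mul] at h
    linear_combination T (-1) * h - D (T (-1)) * hTT - (T (-1) ^ 4 + T (-1) ^ 2) * two
  have hDω (k : Fin r) : D (C (ω k)) = (T (-1) ^ 2 + T (-1)) * C (ω k) := by
    rw [hDC, hm2, Finset.sum_eq_single k (fun i _ hi => by rw [hder, if_neg hi, mul_zero, map_zero])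
      (fun h => absurd (Finset.mem_univ k) h), hder, if_pos rfl, mul_one]
  refine ⟨?_, ?_, fun k => ?_⟩
  · have hT : T 1 ∈ D.kerCompSelf := by
      rw [Derivation.mem_kerCompSelf, hDu, hm2, map_add, hDsq, D.map_one_eq_zero, add_zero]
    have hTinv : T (-1) ∈ D.kerCompSelf := by
      rw [Derivation.mem_kerCompSelf, hDinv, show (T (-1) : E[T;T⁻¹]) ^ 4 = (T (-1) ^ 2) ^ 2 by ring,
        map_add, hDsq, hDsq, add_zero]
    have hω' (k : Fin r) : C (ω k) ∈ D.kerCompSelf := by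
      rw [Derivation.mem_kerCompSelf, hDω, D.leibniz, hDω, map_add, hDsq, hDinv, smul_eq_mul,
        smul_eq_mul]
      linear_combination C (ω k) * (T (-1) ^ 4 + T (-1) ^ 3 + T (-1) ^ 2) * two
    have hC (a : E) : C a ∈ D.kerCompSelf := by
      obtain ⟨-, -, hsurj, -⟩ := hω
      obtain ⟨q, rfl⟩ := hsurj a
      induction q using MvPolynomial.induction_on with
      | C c =>
        rw [MvPolynomial.aeval_C]
        exact D.kerCompSelf.algebraMap_mem c
      | add p q hp hq =>
        rw [map_add, map_add]
        exact add_mem hp hq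
      | mul_X p i hp =>
        rw [map_mul, map_mul, MvPolynomial.aeval_X]
        exact mul_mem hp (hω' i)
    intro f
    rw [← Derivation.mem_kerCompSelf]
    induction f using LaurentPolynomial.induction_on with
    | h_C a => exact hC a
    | h_add hp hq => exact add_mem hp hq
    | h_C_mul_T n a h =>
      rw [T_add, ← mul_assoc]
      exact mul_mem h hT
    | h_C_mul_T_Z n a h =>
      rw [sub_eq_add_neg, T_add, ← mul_assoc]
      exact mul_mem h hTinv
  · have h3 : (T 3 : E[T;T⁻¹]) = T 1 ^ 2 * T 1 := by rw [← pow_succ, T_pow]; norm_num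
    have h2 : (T 2 : E[T;T⁻¹]) = T 1 ^ 2 := by rw [T_pow]; norm_num
    rw [h3, D.leibniz, hDsq, hDu, hm2, h2, smul_zero, add_zero, smul_eq_mul]
    linear_combination (T 1 * T (-1) + 1) * hTT
  · rw [map_add, D.leibniz, hDω, hDu, hm2, smul_eq_mul, smul_eq_mul]
    linear_combination C (ω k) * ((T (-1) + 1) * hTT + (T (-1) ^ 2 + T (-1) + 1) * two)
end

section
/- Let F ⊆ E be fields of characteristic 3 such that E admits a p-basis ω₁,…,ω_r over F, with dual derivations ∂₁,…,∂_r. Let D be an F-linear derivation of the Laurent polynomial ring E[u,u⁻¹] satisfying D(u) = u − u⁻¹ and D(λ) = (u⁻¹ − 1)·Σᵢ₌₁^r ωᵢ·∂ᵢ(λ) for all λ ∈ E. Then D∘D∘D = D, D(u²) = 1 − u², and D(ωₖ + ωₖ·u) = 0 for all 1 ≤ k ≤ r. -/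
open LaurentPolynomial

/-- In characteristic `3` the third iterate of a derivation is again a derivation, so the
condition `D (D (D f)) = D f` is stable under products. -/
theorem Derivation.iterate_three_eq_self_mul {F A : Type*} [CommRing F] [CommRing A] [Algebra F A]
    [CharP A 3] (D : Derivation F A A) {f g : A} (hf : D (D (D f)) = D f)
    (hg : D (D (D g)) = D g) : D (D (D (f * g))) = D (f * g) := by
  have h3 : (3 : A) = 0 := CharP.cast_eq_zero A 3
  simp only [Derivation.leibniz, smul_eq_mul, map_add, hf, hg]
  linear_combination (D f * D (D g) + D g * D (D f)) * h3


theorem statement7 (F E : Type*) [Field F] [Field E] [Algebra F E] [CharP F 3]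
    (r : ℕ) (ω : Fin r → E) (hω : IsPBasis F 3 ω)
    (der : Fin r → Derivation F E E)
    (hder : ∀ i j, der i (ω j) = if i = j then (1 : E) else 0)
    (D : Derivation F (LaurentPolynomial E) (LaurentPolynomial E))
    (hDu : D (T 1) = T 1 - T (-1))
    (hDC : ∀ lam : E, D (C lam) =
      (T (-1) - 1) * ∑ i, C (ω i * der i lam)) :
    (∀ f, D (D (D f)) = D f) ∧
    D (T 2) = 1 - T 2 ∧
    ∀ k, D (C (ω k) + C (ω k) * T 1) = 0 := by
  have hE : CharP E 3 := charP_of_injective_algebraMap (algebraMap F E).injective 3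
  have hL : CharP (LaurentPolynomial E) 3 :=
    charP_of_injective_ringHom (C : E →+* LaurentPolynomial E).injective 3
  have h3 : (3 : LaurentPolynomial E) = 0 := CharP.cast_eq_zero _ 3
  have huv : (T 1 : LaurentPolynomial E) * T (-1) = 1 := by rw [← T_add]; simp
  have hT2 : (T 2 : LaurentPolynomial E) = T 1 * T 1 := by rw [← T_add]; rfl
  have hDω : ∀ k, D (C (ω k)) = (T (-1) - 1) * C (ω k) := by
    intro k
    rw [hDC, Finset.sum_eq_single k] <;> simp +contextual [hder]
  have hDv : D (T (-1)) = T (-1) ^ 3 - T (-1) := by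
    have h := congrArg D huv
    simp only [Derivation.leibniz, smul_eq_mul, hDu, Derivation.map_one_eq_zero] at h
    linear_combination T (-1) * h - (D (T (-1)) + T (-1)) * huv
  obtain ⟨-, -, hsurj, -⟩ := hω
  refine ⟨?_, ?_, ?_⟩
  · have hDv3 : D (T (-1) ^ 3) = 0 := by
      rw [Derivation.leibniz_pow]
      simp [h3]
    have hu : D (D (D (T 1))) = D (T 1) := by
      simp only [hDu, map_sub, hDv, hDv3]
      ring
    have hv : D (D (D (T (-1)))) = D (T (-1)) := by
      simp only [map_sub, map_zero, hDv, hDv3]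
      ring
    have hT : ∀ n : ℕ, D (D (D (T n))) = D (T n) ∧ D (D (D (T (-n)))) = D (T (-n)) := by
      intro n
      induction n with
      | zero => simp
      | succ n ih =>
        push_cast
        rw [neg_add, T_add, T_add]
        exact ⟨D.iterate_three_eq_self_mul ih.1 hu, D.iterate_three_eq_self_mul ih.2 hv⟩
    have hC : ∀ a : E, D (D (D (C a))) = D (C a) := by
      intro a
      obtain ⟨q, rfl⟩ := hsurj a
      induction q using MvPolynomial.induction_on with
      | C c => simp [hDC]
      | add q₁ q₂ h₁ h₂ => simp only [map_add, h₁, h₂]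
      | mul_X q k hq =>
        rw [map_mul, map_mul, MvPolynomial.aeval_X]
        refine D.iterate_three_eq_self_mul hq ?_
        simp only [hDω, Derivation.leibniz, smul_eq_mul, map_add, map_sub, map_zero, hDv, hDv3,
          Derivation.map_one_eq_zero]
        linear_combination (T (-1) ^ 4 - T (-1) ^ 3 - 2 * T (-1) ^ 2 + 2 * T (-1)) * C (ω k) * h3
    intro f
    induction f using LaurentPolynomial.induction_on' with
    | add f g hf hg => simp only [map_add, hf, hg]
    | C_mul_T n a =>
      refine D.iterate_three_eq_self_mul (hC a) ?_
      obtain ⟨m, rfl | rfl⟩ := n.eq_nat_or_neg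
      exacts [(hT m).1, (hT m).2]
  · rw [hT2, Derivation.leibniz, smul_eq_mul, hDu]
    linear_combination (T 1 ^ 2 - 1) * h3 - 2 * huv
  · intro k
    rw [map_add, Derivation.leibniz, smul_eq_mul, smul_eq_mul, hDu, hDω]
    linear_combination C (ω k) * huv
end

section
/- Let A be a Noetherian regular local ring with maximal ideal 𝔪 and residue field k, let n ≥ 2, and let 𝔞 ⊆ 𝔪ⁿ be an ideal generated by a regular sequence f₁,…,f_r ∈ 𝔪. Set R = A/𝔞, with maximal ideal 𝔪_R. Then dim_k((𝔞 + 𝔪ⁿ⁺¹)/𝔪ⁿ⁺¹) ≤ dim_k(𝔪_R/𝔪_R²) − dim R, where dim R denotes the Krull dimension of R. -/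
open IsLocalRing in
/-- If finitely many vectors span `k ^ d` over a local ring with residue field `k`, then there
are at least `d` of them. -/
theorem le_of_forall_eq_sum_smul_residueField {A : Type*} [CommRing A] [IsLocalRing A] {r d : ℕ}
    (u : Fin r → Fin d → ResidueField A)
    (hu : ∀ w, ∃ c : Fin r → A, w = ∑ i, c i • u i) : d ≤ r := by
  have htop : Submodule.span (ResidueField A) (Set.range u) = ⊤ := by
    refine eq_top_iff.2 fun w _ ↦ ?_
    obtain ⟨c, rfl⟩ := hu w
    refine Submodule.sum_mem _ fun i _ ↦ ?_
    rw [← algebraMap_smul (ResidueField A) (c i) (u i)]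
    exact Submodule.smul_mem _ _ (Submodule.subset_span ⟨i, rfl⟩)
  have h := finrank_range_le_card (R := ResidueField A) u
  rw [Set.finrank, htop, finrank_top] at h
  simpa using h

open IsLocalRing in
/-- If a local ring has a quotient by an ideal inside the square of the maximal ideal `𝔪`, then
any spanning family of the cotangent space of the quotient has at least `dim A` elements. -/
theorem ringKrullDim_le_of_cotangent_eq_sum_smul {A : Type*} [CommRing A] [IsNoetherianRing A]
    [IsLocalRing A] {I : Ideal A} (hI : I ≤ maximalIdeal A ^ 2) {e : ℕ}
    (v : Fin e → ((maximalIdeal A).map (Ideal.Quotient.mk I)).Cotangent)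
    (hv : ∀ w, ∃ c : Fin e → A ⧸ I, w = ∑ i, c i • v i) : ringKrullDim A ≤ e := by
  generalize hJ : (maximalIdeal A).map (Ideal.Quotient.mk I) = J at v hv
  have hsurj : Function.Surjective (Ideal.Quotient.mk I) := Ideal.Quotient.mk_surjective
  have hlift : ∀ i, ∃ x ∈ maximalIdeal A, ∃ hx : Ideal.Quotient.mk I x ∈ J,
      v i = J.toCotangent ⟨Ideal.Quotient.mk I x, hx⟩ := by
    intro i
    obtain ⟨⟨y, hy⟩, hyv⟩ := J.toCotangent_surjective (v i)
    obtain ⟨x, hx, rfl⟩ := (Ideal.mem_map_iff_of_surjective _ hsurj).1 (hJ ▸ hy)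
    exact ⟨x, hx, hy, hyv.symm⟩
  choose x hx hxJ hxv using hlift
  have hle : maximalIdeal A ≤ Ideal.span (Set.range x) := by
    refine Submodule.le_of_le_smul_of_le_jacobson_bot (I := maximalIdeal A)
      (IsNoetherian.noetherian _) (jacobson_eq_maximalIdeal _ bot_ne_top).ge fun a ha ↦ ?_
    obtain ⟨c, hc⟩ := hv (J.toCotangent ⟨Ideal.Quotient.mk I a, hJ ▸ Ideal.mem_map_of_mem _ ha⟩)
    choose s hs using fun i ↦ hsurj (c i)
    have hsum : (∑ i, c i • v i) =
        J.toCotangent (∑ i, c i • ⟨Ideal.Quotient.mk I (x i), hxJ i⟩) := by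
      simp only [map_sum, map_smul, hxv]
    rw [hsum, Ideal.toCotangent_eq] at hc
    have hmem : Ideal.Quotient.mk I (a - ∑ i, s i * x i) ∈
        (maximalIdeal A ^ 2).map (Ideal.Quotient.mk I) := by
      rw [Ideal.map_pow, hJ]
      simpa [← hs] using hc
    rw [Ideal.mem_map_iff_of_surjective _ hsurj] at hmem
    obtain ⟨b, hb, hab⟩ := hmem
    have hsq : a - ∑ i, s i * x i ∈ maximalIdeal A ^ 2 := by
      rw [← sub_sub_cancel b (a - ∑ i, s i * x i)]
      exact sub_mem hb (hI (Ideal.Quotient.eq.1 hab))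
    rw [← add_sub_cancel (∑ i, s i * x i) a]
    refine Submodule.add_mem_sup (Ideal.sum_mem _ fun i _ ↦ ?_) ?_
    · exact Ideal.mul_mem_left _ _ (Ideal.subset_span ⟨i, rfl⟩)
    · rwa [smul_eq_mul, ← pow_two]
  have hspan : maximalIdeal A = Ideal.span (Set.range x) :=
    hle.antisymm (Ideal.span_le.2 (Set.range_subset_iff.2 hx))
  have hheight : (maximalIdeal A).height ≤ (e : ℕ∞) := by
    refine ((maximalIdeal A).height_le_spanFinrank Ideal.IsPrime.ne_top').trans ?_
    rw [hspan, Nat.cast_le]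
    refine (Submodule.spanFinrank_span_le_ncard_of_finite (Set.finite_range x)).trans ?_
    rw [← Set.image_univ]
    exact (Set.ncard_image_le Set.finite_univ).trans (by simp)
  rw [← maximalIdeal_height_eq_ringKrullDim]
  exact_mod_cast hheight

/-- Let `A` be a Noetherian regular local ring, `n ≥ 2`, and
`𝔞 ⊆ 𝔪ⁿ` an ideal generated by a regular sequence.  Set `R = A/𝔞`.  Then
`dim_k((𝔞 + 𝔪ⁿ⁺¹)/𝔪ⁿ⁺¹) ≤ dim_k(𝔪_R/𝔪_R²) − dim R`.  (Dimensions of the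
`k`-vector spaces are expressed via `A`- resp. `R`-linear isomorphisms with
powers of the residue field, and `dim R` via `ringKrullDim`.) -/
theorem statement13 (A : Type*) [CommRing A] [IsNoetherianRing A] [IsLocalRing A]
    -- `A` is regular: its maximal ideal is generated by `dim A` elements,
    (hreg : ∃ (m : ℕ) (g : Fin m → A),
      IsLocalRing.maximalIdeal A = Ideal.span (Set.range g) ∧
      ringKrullDim A = (m : WithBot ℕ∞))
    (n : ℕ) (hn : 2 ≤ n)
    -- `𝔞` is generated by a regular sequence `f₁, …, f_r ∈ 𝔪`,
    (r : ℕ) (f : Fin r → A) (hf : ∀ i, f i ∈ IsLocalRing.maximalIdeal A)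
    (hfreg : RingTheory.Sequence.IsRegular A (List.ofFn f))
    (𝔞 : Ideal A) (h𝔞 : 𝔞 = Ideal.span (Set.range f))
    -- and `𝔞 ⊆ 𝔪ⁿ`:
    (h𝔞n : 𝔞 ≤ IsLocalRing.maximalIdeal A ^ n)
    -- `dQ = dim_k((𝔞 + 𝔪ⁿ⁺¹)/𝔪ⁿ⁺¹)`:
    (dQ : ℕ)
    (hdQ : Nonempty
      ((↥(𝔞 ⊔ IsLocalRing.maximalIdeal A ^ (n + 1)) ⧸
          Submodule.comap
            (𝔞 ⊔ IsLocalRing.maximalIdeal A ^ (n + 1) : Ideal A).subtype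
            (IsLocalRing.maximalIdeal A ^ (n + 1) : Ideal A)) ≃ₗ[A]
        (Fin dQ → IsLocalRing.ResidueField A)))
    -- `e = dim_k(𝔪_R/𝔪_R²)`, where `R = A/𝔞` and `𝔪_R = 𝔪·R`:
    (e : ℕ)
    (he : Nonempty
      ((((IsLocalRing.maximalIdeal A).map (Ideal.Quotient.mk 𝔞)).Cotangent) ≃ₗ[A ⧸ 𝔞]
        (Fin e → ((A ⧸ 𝔞) ⧸ (IsLocalRing.maximalIdeal A).map (Ideal.Quotient.mk 𝔞)))))
    -- `d = dim R`:
    (d : ℕ) (hd : ringKrullDim (A ⧸ 𝔞) = (d : WithBot ℕ∞)) :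
    dQ ≤ e - d := by
  obtain ⟨m, -, -, hm⟩ := hreg
  obtain ⟨E⟩ := hdQ
  obtain ⟨F⟩ := he
  have hdim : d + r = m := by
    have h := ringKrullDim_add_length_eq_ringKrullDim_of_isRegular (List.ofFn f) hfreg
    have hof : Ideal.ofList (List.ofFn f) = 𝔞 := by
      rw [h𝔞, Ideal.ofList]
      congr 1
      ext
      simp [List.mem_ofFn]
    rw [hof, hd, hm, List.length_ofFn] at h
    exact_mod_cast h
  have hme : m ≤ e := by
    have h : ringKrullDim A ≤ e := by
      refine ringKrullDim_le_of_cotangent_eq_sum_smul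
        (h𝔞n.trans (Ideal.pow_le_pow_right hn)) (fun i ↦ F.symm (Pi.single i 1)) fun w ↦ ?_
      choose c hc using fun i ↦ Ideal.Quotient.mk_surjective (F w i)
      refine ⟨c, F.injective ?_⟩
      ext i
      simp [Finset.sum_apply, Pi.single_apply, ← hc, Algebra.smul_def]
    rw [hm] at h
    exact_mod_cast h
  have hr : dQ ≤ r := by
    have hfa : ∀ i, f i ∈ 𝔞 ⊔ IsLocalRing.maximalIdeal A ^ (n + 1) := fun i ↦
      Ideal.mem_sup_left (h𝔞 ▸ Ideal.subset_span ⟨i, rfl⟩)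
    refine le_of_forall_eq_sum_smul_residueField
      (fun i ↦ E (Submodule.Quotient.mk ⟨f i, hfa i⟩)) fun w ↦ ?_
    obtain ⟨⟨x, hx⟩, hxw⟩ := Submodule.Quotient.mk_surjective _ (E.symm w)
    obtain ⟨y, hy, z, hz, rfl⟩ := Submodule.mem_sup.1 hx
    rw [h𝔞, Ideal.mem_span_range_iff_exists_fun] at hy
    obtain ⟨c, rfl⟩ := hy
    refine ⟨c, ?_⟩
    rw [← E.apply_symm_apply w, ← hxw]
    simp only [← map_smul, ← map_sum, ← Submodule.mkQ_apply]
    congr 1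
    refine (Submodule.Quotient.eq _).2 ?_
    simpa using hz
  omega
end

section
/- Let L ⊆ E be fields with 3 ≤ [E:L] < ∞, and let H ⊆ E be an L-linear subspace with dim_L(E/H) = 1 (an L-hyperplane). Then for every integer k ≥ 2, the L-linear span of the set of all k-fold products h₁·h₂·⋯·h_k with h₁,…,h_k ∈ H equals E. -/
section HyperplaneProducts

variable {L E : Type*} [Field L] [Field E] [Algebra L E]

theorem Submodule.finrank_map_mulLeft (H : Submodule L E) {a : E} (ha : a ≠ 0) :
    Module.finrank L (H.map (LinearMap.mulLeft L a)) = Module.finrank L H :=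
  (H.equivMapOfInjective _ (mul_right_injective₀ ha)).finrank_eq.symm

/-- If the product of a hyperplane with itself is proper, then all nonzero multiples of the
hyperplane by its own elements coincide with that product. -/
theorem Submodule.map_mulLeft_eq_mul_self [FiniteDimensional L E] {H : Submodule L E}
    (hH : Module.finrank L H + 1 = Module.finrank L E) (hne : H * H ≠ ⊤)
    {a : E} (haH : a ∈ H) (ha : a ≠ 0) : H.map (LinearMap.mulLeft L a) = H * H := by
  apply Submodule.eq_of_le_of_finrank_le
  · rintro _ ⟨b, hb, rfl⟩
    exact Submodule.mul_mem_mul haH hb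
  · rw [H.finrank_map_mulLeft ha]
    have := Submodule.finrank_lt hne
    omega

theorem Submodule.mul_self_eq_top_of_hyperplane [FiniteDimensional L E]
    (hdeg : 3 ≤ Module.finrank L E) {H : Submodule L E}
    (hH : Module.finrank L H + 1 = Module.finrank L E) : H * H = ⊤ := by
  by_contra hne
  obtain ⟨a, haH, ha⟩ : ∃ a ∈ H, a ≠ 0 := by
    apply H.exists_mem_ne_zero_of_ne_bot
    rintro rfl
    rw [finrank_bot] at hH
    omega
  obtain ⟨y, hy⟩ : ∃ y, y ∉ H := by
    by_contra! hall
    rw [(Submodule.eq_top_iff'.2 hall : H = ⊤), finrank_top] at hH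
    omega
  have hy0 : y ≠ 0 := fun h => hy (h ▸ H.zero_mem)
  have hx : a⁻¹ * y ≠ 0 := mul_ne_zero (inv_ne_zero ha) hy0
  have hdisj : Disjoint H (H.map (LinearMap.mulLeft L (a⁻¹ * y))) := by
    rw [Submodule.disjoint_def]
    rintro _ hc ⟨b, hb, rfl⟩
    rw [LinearMap.mulLeft_apply] at hc ⊢
    by_contra hxb
    have hb0 : b ≠ 0 := right_ne_zero_of_mul hxb
    have hmem : a⁻¹ * y * b * a ∈ H.map (LinearMap.mulLeft L b) := by
      rw [Submodule.map_mulLeft_eq_mul_self hH hne hb hb0]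
      exact Submodule.mul_mem_mul hc haH
    obtain ⟨d, hd, hbd⟩ := hmem
    rw [LinearMap.mulLeft_apply] at hbd
    have : d = y := by
      apply mul_left_cancel₀ hb0
      rw [hbd]
      field_simp
    exact hy (this ▸ hd)
  have := Submodule.finrank_add_finrank_le_of_disjoint hdisj
  rw [H.finrank_map_mulLeft hx] at this
  omega

theorem Submodule.top_mul_eq_top {H : Submodule L E} (hH : H ≠ ⊥) : ⊤ * H = ⊤ := by
  obtain ⟨a, haH, ha⟩ := H.exists_mem_ne_zero_of_ne_bot hH
  refine Submodule.eq_top_iff'.2 fun x => ?_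
  rw [← div_mul_cancel₀ x ha]
  exact Submodule.mul_mem_mul Submodule.mem_top haH

theorem Submodule.span_fin_prod_eq_pow (H : Submodule L E) (k : ℕ) :
    Submodule.span L {x : E | ∃ h : Fin k → E, (∀ i, h i ∈ H) ∧ x = ∏ i, h i} = H ^ k := by
  rw [Submodule.pow_eq_span_pow_set]
  congr 1
  ext x
  simp only [Set.mem_ofPred_eq, Set.mem_pow, List.prod_ofFn]
  constructor
  · rintro ⟨h, hh, rfl⟩
    exact ⟨fun i => ⟨h i, hh i⟩, rfl⟩
  · rintro ⟨f, rfl⟩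
    exact ⟨fun i => f i, fun i => (f i).2, rfl⟩

end HyperplaneProducts

/-- If `L ⊆ E` are fields with `3 ≤ [E:L] < ∞` and `H ⊆ E` is
an `L`-hyperplane, then for every `k ≥ 2` the `L`-span of all `k`-fold products
of elements of `H` is all of `E`. -/
theorem statement14 (L E : Type*) [Field L] [Field E] [Algebra L E]
    [FiniteDimensional L E] (hdeg : 3 ≤ Module.finrank L E)
    (H : Submodule L E) (hH : Module.finrank L (E ⧸ H) = 1) :
    ∀ k : ℕ, 2 ≤ k →
      Submodule.span L
        {x : E | ∃ h : Fin k → E, (∀ i, h i ∈ H) ∧ x = ∏ i, h i} = ⊤ := by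
  have hcodim : Module.finrank L H + 1 = Module.finrank L E := by
    rw [← H.finrank_quotient_add_finrank, hH, add_comm]
  have hbot : H ≠ ⊥ := by
    rintro rfl
    rw [finrank_bot] at hcodim
    omega
  intro k hk
  rw [Submodule.span_fin_prod_eq_pow]
  induction k, hk using Nat.le_induction with
  | base => rw [pow_two, Submodule.mul_self_eq_top_of_hyperplane hdeg hcodim]
  | succ k _ ih => rw [pow_succ, ih, Submodule.top_mul_eq_top hbot]
end

section
/- Let Ω be a field of characteristic p > 0, and let E, K ⊆ Ω be subfields with [Ω:E] = [Ω:K] = 2 such that Ω is purely inseparable over K. Set F = E ∩ K. Then p = 2, and there exists ξ ∈ Ω with [F(ξ):F] = 2 and ξ ∉ E; consequently [E(ξ):E] = 2 and E ⊗_F F(ξ) is a field. -/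
set_option synthInstance.maxHeartbeats 1000000
set_option maxHeartbeats 2000000

open IntermediateField Polynomial

/-- A quadratic element outside the base field generates an extension of degree two. -/
theorem finrank_adjoin_eq_two_of_quadratic {F L : Type*} [Field F] [Field L] [Algebra F L]
    {x : L} (hx : x ∉ (algebraMap F L).range) (a b : F)
    (h : x ^ 2 = algebraMap F L a * x + algebraMap F L b) :
    Module.finrank F F⟮x⟯ = 2 := by
  have hdeg : (X ^ 2 - (C a * X + C b) : F[X]).natDegree = 2 := by compute_degree!
  have hmonic : (X ^ 2 - (C a * X + C b) : F[X]).Monic := by monicity!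
  have hroot : aeval x (X ^ 2 - (C a * X + C b) : F[X]) = 0 := by simp [h]
  have hint : IsIntegral F x := ⟨_, hmonic, hroot⟩
  rw [adjoin.finrank hint]
  refine le_antisymm ?_ ((minpoly.two_le_natDegree_iff hint).2 hx)
  exact hdeg ▸ natDegree_le_of_dvd (minpoly.dvd F x hroot) hmonic.ne_zero

/-- In a quadratic extension, `1` and any element outside the base field span. -/
theorem exists_eq_add_mul_of_finrank_eq_two {F L : Type*} [Field F] [Field L] [Algebra F L]
    (h2 : Module.finrank F L = 2) {x : L} (hx : x ∉ (algebraMap F L).range) (y : L) :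
    ∃ a b : F, y = algebraMap F L a * x + algebraMap F L b := by
  have hli : LinearIndependent F ![x, 1] := by
    rw [LinearIndependent.pair_symm_iff, LinearIndependent.pair_iff' one_ne_zero]
    rintro a rfl
    exact hx ⟨a, Algebra.algebraMap_eq_smul_one a⟩
  have hspan := hli.span_eq_top_of_card_eq_finrank (by simp [h2])
  have hy : y ∈ Submodule.span F (Set.range ![x, 1]) := hspan ▸ Submodule.mem_top
  rw [Matrix.range_cons_cons_empty, Submodule.mem_span_pair] at hy
  obtain ⟨a, b, rfl⟩ := hy
  exact ⟨a, b, by simp [Algebra.smul_def]⟩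

/-- A purely inseparable extension of degree two in characteristic `p` has `p = 2`, and
contains the square of every element in the base field. -/
theorem IsPurelyInseparable.eq_two_and_sq_mem_of_finrank_eq_two {F L : Type*} [Field F] [Field L]
    [Algebra F L] [IsPurelyInseparable F L] (p : ℕ) [ExpChar F p]
    (h2 : Module.finrank F L = 2) :
    p = 2 ∧ ∀ x : L, x ^ 2 ∈ (algebraMap F L).range := by
  have : FiniteDimensional F L := Module.finite_of_finrank_eq_succ h2
  have hp2 : p = 2 := by
    obtain ⟨n, hn⟩ := IsPurelyInseparable.finrank_eq_pow F L p
    rw [h2] at hn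
    exact ((Nat.prime_dvd_prime_iff_eq Nat.prime_two
      ((expChar_is_prime_or_one F p).resolve_right (by rintro rfl; simp at hn))).1
      (Nat.prime_two.dvd_of_dvd_pow hn.dvd)).symm
  subst hp2
  refine ⟨rfl, fun x => ?_⟩
  have hle : 2 ^ IsPurelyInseparable.elemExponent F x ≤ 2 ^ 1 := by
    rw [← IsPurelyInseparable.minpoly_natDegree_eq' F 2 x, pow_one, ← h2]
    exact minpoly.natDegree_le x
  have hmem := IsPurelyInseparable.elemExponent_def' F 2 x
  generalize IsPurelyInseparable.elemExponent F x = e at hle hmem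
  obtain rfl | rfl : e = 0 ∨ e = 1 := by
    have := (Nat.pow_le_pow_iff_right one_lt_two).1 hle
    omega
  · rw [pow_zero, pow_one] at hmem
    exact _root_.pow_mem hmem 2
  · simpa using hmem

/-- If `L / E` is quadratic and generated by an element of a quadratic extension of `F`, then the
tensor product of `E` with that extension is a field. -/
theorem isField_tensorProduct_adjoin_of_finrank_eq_two {F E L : Type*} [Field F] [Field E]
    [Field L] [Algebra F E] [Algebra E L] [Algebra F L] [IsScalarTower F E L]
    (h2 : Module.finrank E L = 2) {x : L} (hx : x ∉ (algebraMap E L).range)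
    (hF : Module.finrank F F⟮x⟯ = 2) :
    IsField (TensorProduct F E F⟮x⟯) := by
  let f : TensorProduct F E F⟮x⟯ →ₐ[E] L :=
    Algebra.TensorProduct.lift (Algebra.ofId E L) F⟮x⟯.val fun _ _ => Commute.all _ _
  have hsurj : Function.Surjective f := fun y => by
    obtain ⟨a, b, rfl⟩ := exists_eq_add_mul_of_finrank_eq_two h2 hx y
    exact ⟨a ⊗ₜ[F] AdjoinSimple.gen F x + b ⊗ₜ[F] 1, by simp [f, Algebra.ofId_apply]⟩
  have : FiniteDimensional F F⟮x⟯ := Module.finite_of_finrank_eq_succ hF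
  have : FiniteDimensional E L := Module.finite_of_finrank_eq_succ h2
  have hinj : Function.Injective f :=
    (LinearMap.injective_iff_surjective_of_finrank_eq_finrank (f := f.toLinearMap)
      (by rw [Module.finrank_baseChange, hF, h2])).2 hsurj
  exact (AlgEquiv.ofBijective f ⟨hinj, hsurj⟩).toMulEquiv.isField (Field.toIsField L)

theorem statement15 (Ω : Type*) [Field Ω] (p : ℕ) (hp : 0 < p) [CharP Ω p]
    (E K : Subfield Ω)
    (hE : Module.finrank E Ω = 2) (hK : Module.finrank K Ω = 2)
    (hins : IsPurelyInseparable K Ω) :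
    p = 2 ∧ ∃ ξ : Ω, ξ ∉ E ∧
      Module.finrank ↥(E ⊓ K) (IntermediateField.adjoin ↥(E ⊓ K) {ξ}) = 2 ∧
      Module.finrank ↥E (IntermediateField.adjoin ↥E {ξ}) = 2 ∧
      (letI : Algebra ↥(E ⊓ K) ↥E :=
        (Subfield.inclusion (inf_le_left : E ⊓ K ≤ E)).toAlgebra
      IsField (TensorProduct ↥(E ⊓ K) ↥E
        (IntermediateField.adjoin ↥(E ⊓ K) {ξ}))) := by
  have : NeZero p := ⟨hp.ne'⟩
  have : Fact p.Prime := CharP.char_is_prime_of_pos Ω p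
  have : CharP K p := inferInstance
  obtain ⟨rfl, hsq⟩ :=
    IsPurelyInseparable.eq_two_and_sq_mem_of_finrank_eq_two (F := K) (L := Ω) p hK
  have hsqK (x : Ω) : x ^ 2 ∈ K := by
    obtain ⟨y, hy⟩ := hsq x
    exact hy ▸ y.2
  have hrange {M : Subfield Ω} {x : Ω} : x ∈ (algebraMap M Ω).range ↔ x ∈ M :=
    ⟨by rintro ⟨y, rfl⟩; exact y.2, fun h => ⟨⟨x, h⟩, rfl⟩⟩
  obtain ⟨x, hx⟩ : ∃ x, x ∉ E := by
    by_contra! h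
    have htop : (⊥ : Subalgebra E Ω) = ⊤ := eq_top_iff.2 fun x _ => ⟨⟨x, h x⟩, rfl⟩
    have := Subalgebra.bot_eq_top_iff_finrank_eq_one.1 htop
    omega
  obtain ⟨ξ, hξ, a, b, hab⟩ : ∃ ξ, ξ ∉ E ∧
      ∃ a b : ↥(E ⊓ K), ξ ^ 2 = (a : Ω) * ξ + (b : Ω) := by
    obtain ⟨t, n, htn⟩ := exists_eq_add_mul_of_finrank_eq_two hE (mt hrange.1 hx) (x ^ 2)
    change x ^ 2 = (t : Ω) * x + (n : Ω) at htn
    by_cases ht : (t : Ω) = 0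
    · have hxn : x ^ 2 = (n : Ω) := by simpa [ht] using htn
      exact ⟨x, hx, 0, ⟨x ^ 2, hxn ▸ n.2, hsqK x⟩, by simp⟩
    · refine ⟨x ^ 2, fun h => hx ?_, ⟨t ^ 2, pow_mem t.2 2, hsqK _⟩,
        ⟨n ^ 2, pow_mem n.2 2, hsqK _⟩, ?_⟩
      · have : x = (x ^ 2 - n) / t := by rw [htn]; field_simp; ring
        exact this ▸ div_mem (sub_mem h n.2) t.2
      · change (x ^ 2) ^ 2 = (t : Ω) ^ 2 * x ^ 2 + (n : Ω) ^ 2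
        conv_lhs => rw [htn]
        rw [CharTwo.add_sq, mul_pow]
  have hF : Module.finrank ↥(E ⊓ K) (IntermediateField.adjoin ↥(E ⊓ K) {ξ}) = 2 :=
    finrank_adjoin_eq_two_of_quadratic (fun h => hξ (hrange.1 h).1) a b hab
  refine ⟨rfl, ξ, hξ, hF, ?_, ?_⟩
  · exact finrank_adjoin_eq_two_of_quadratic (mt hrange.1 hξ)
      (Subfield.inclusion inf_le_left a) (Subfield.inclusion inf_le_left b) hab
  · let : Algebra ↥(E ⊓ K) ↥E :=
      (Subfield.inclusion (inf_le_left : E ⊓ K ≤ E)).toAlgebra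
    have : IsScalarTower ↥(E ⊓ K) ↥E Ω := IsScalarTower.of_algebraMap_eq fun _ => rfl
    exact isField_tensorProduct_adjoin_of_finrank_eq_two hE (mt hrange.1 hξ) hF
end

section
/- Let F ⊆ E be fields of characteristic 2, let ω ∈ E, and let ∂ : E → E be an F-linear derivation with ∂(ω) = 1 and ∂∘∂ = 0. Let D and D̃ be F-linear derivations of the Laurent polynomial ring E[u,u⁻¹] satisfying D(u) = 1, D(λ) = ω·u⁻¹·∂(λ) for all λ ∈ E, and D̃(u) = u², D̃(λ) = ω·u·∂(λ) for all λ ∈ E. Then D∘D = 0, D̃∘D̃ = 0, D∘D̃ = D̃∘D, and D(ω·u) = D(ω·u⁻¹) = D̃(ω·u) = D̃(ω·u⁻¹) = 0. -/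
open LaurentPolynomial

/-- The square of a derivation on an algebra of characteristic two is a derivation. -/
def Derivation.squareOfCharTwo {R A : Type*} [CommRing R] [CommRing A] [Algebra R A] [CharP A 2]
    (D : Derivation R A A) : Derivation R A A :=
  Derivation.mk' ((D : A →ₗ[R] A) ∘ₗ (D : A →ₗ[R] A)) fun a b => by
    have h : (2 : A) = 0 := CharTwo.two_eq_zero
    simp only [LinearMap.comp_apply, Derivation.coeFn_coe, Derivation.leibniz, map_add,
      smul_eq_mul]
    linear_combination D a * D b * h

theorem Derivation.squareOfCharTwo_apply {R A : Type*} [CommRing R] [CommRing A] [Algebra R A]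
    [CharP A 2] (D : Derivation R A A) (a : A) : D.squareOfCharTwo a = D (D a) :=
  rfl

theorem LaurentPolynomial.T_one_mul_T_neg_one {R : Type*} [CommRing R] :
    (T 1 : R[T;T⁻¹]) * T (-1) = 1 := by
  rw [← T_add, add_neg_cancel, T_zero]

theorem LaurentPolynomial.T_two_eq {R : Type*} [CommRing R] :
    (T 2 : R[T;T⁻¹]) = T 1 * T 1 := by
  rw [← T_add, one_add_one_eq_two]

theorem Derivation.laurentPolynomial_T_neg_one {F R : Type*} [CommRing F] [CommRing R]
    [Algebra F R] (D : Derivation F R[T;T⁻¹] R[T;T⁻¹]) :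
    D (T (-1)) = -(T (-1) * T (-1) * D (T 1)) := by
  have h := congrArg D (T_one_mul_T_neg_one (R := R))
  rw [D.leibniz, D.map_one_eq_zero, smul_eq_mul, smul_eq_mul] at h
  linear_combination T (-1) * h - D (T (-1)) * T_one_mul_T_neg_one (R := R)

theorem Derivation.laurentPolynomial_eq_zero {F R : Type*} [CommRing F] [CommRing R]
    [Algebra F R] (D : Derivation F R[T;T⁻¹] R[T;T⁻¹]) (hC : ∀ a, D (C a) = 0)
    (hT : D (T 1) = 0) (f : R[T;T⁻¹]) : D f = 0 := by
  have hT' : D (T (-1)) = 0 := by rw [D.laurentPolynomial_T_neg_one, hT, mul_zero, neg_zero]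
  induction f using LaurentPolynomial.induction_on with
  | h_C a => exact hC a
  | h_add hp hq => rw [map_add, hp, hq, add_zero]
  | h_C_mul_T n a h =>
    rw [T_add, ← mul_assoc, D.leibniz, h, hT, smul_zero, smul_zero, add_zero]
  | h_C_mul_T_Z n a h =>
    rw [T_sub, ← mul_assoc, D.leibniz, h, hT', smul_zero, smul_zero, add_zero]

theorem statement16 (F E : Type*) [Field F] [Field E] [Algebra F E] [CharP F 2]
    (ω : E) (der : Derivation F E E) (hder1 : der ω = 1)
    (hder2 : ∀ x, der (der x) = 0)
    (D Dt : Derivation F (LaurentPolynomial E) (LaurentPolynomial E))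
    (hDu : D (T 1) = 1)
    (hDC : ∀ lam : E, D (C lam) = C ω * T (-1) * C (der lam))
    (hDtu : Dt (T 1) = T 2)
    (hDtC : ∀ lam : E, Dt (C lam) = C ω * T 1 * C (der lam)) :
    (∀ f, D (D f) = 0) ∧ (∀ f, Dt (Dt f) = 0) ∧
    (∀ f, D (Dt f) = Dt (D f)) ∧
    D (C ω * T 1) = 0 ∧ D (C ω * T (-1)) = 0 ∧
    Dt (C ω * T 1) = 0 ∧ Dt (C ω * T (-1)) = 0 := by
  have : CharP E[T;T⁻¹] 2 := charP_of_injective_algebraMap (algebraMap F E[T;T⁻¹]).injective 2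
  have h2 : (2 : E[T;T⁻¹]) = 0 := CharTwo.two_eq_zero
  have huv := T_one_mul_T_neg_one (R := E)
  have hDv := D.laurentPolynomial_T_neg_one
  have hDtv := Dt.laurentPolynomial_T_neg_one
  rw [hDu] at hDv
  rw [hDtu, T_two_eq] at hDtv
  rw [T_two_eq] at hDtu
  have a1 : D (C ω * T 1) = 0 := by
    rw [D.leibniz, hDu, hDC, hder1, map_one, smul_eq_mul, smul_eq_mul]
    linear_combination C ω * huv + C ω * h2
  have a2 : D (C ω * T (-1)) = 0 := by
    rw [D.leibniz, hDv, hDC, hder1, map_one, smul_eq_mul, smul_eq_mul]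
    ring
  have a3 : Dt (C ω * T 1) = 0 := by
    rw [Dt.leibniz, hDtu, hDtC, hder1, map_one, smul_eq_mul, smul_eq_mul]
    linear_combination C ω * T 1 * T 1 * h2
  have a4 : Dt (C ω * T (-1)) = 0 := by
    rw [Dt.leibniz, hDtv, hDtC, hder1, map_one, smul_eq_mul, smul_eq_mul]
    linear_combination -C ω * T 1 * T (-1) * huv
  refine ⟨fun f => ?_, fun f => ?_, fun f => ?_, a1, a2, a3, a4⟩
  · rw [← D.squareOfCharTwo_apply]
    refine D.squareOfCharTwo.laurentPolynomial_eq_zero (fun a => ?_) ?_ f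
    · rw [D.squareOfCharTwo_apply, hDC, D.leibniz, a2, hDC, hder2]
      simp
    · rw [D.squareOfCharTwo_apply, hDu, D.map_one_eq_zero]
  · rw [← Dt.squareOfCharTwo_apply]
    refine Dt.squareOfCharTwo.laurentPolynomial_eq_zero (fun a => ?_) ?_ f
    · rw [Dt.squareOfCharTwo_apply, hDtC, Dt.leibniz, a3, hDtC, hder2]
      simp
    · rw [Dt.squareOfCharTwo_apply, hDtu, Dt.leibniz, ← two_smul E[T;T⁻¹], h2, zero_smul]
  · rw [← sub_eq_zero, ← Derivation.commutator_apply]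
    refine Derivation.laurentPolynomial_eq_zero _ (fun a => ?_) ?_ f
    · rw [Derivation.commutator_apply, hDC, hDtC, D.leibniz, Dt.leibniz, a1, a4, hDC, hDtC, hder2]
      simp
    · rw [Derivation.commutator_apply, hDu, hDtu, D.leibniz, Dt.map_one_eq_zero,
        ← two_smul E[T;T⁻¹], h2, zero_smul, sub_zero]
end

section
/- Let F ⊆ E be fields of characteristic 3 such that E admits a p-basis ω₁,…,ω_r over F (r ≥ 1), with dual derivations ∂₁,…,∂_r. Let D be an F-linear derivation of the Laurent polynomial ring E[u,u⁻¹] satisfying D(u) = −ω_r⁻¹·(1+u) and D(λ) = (1−u⁻¹)·∂_r(λ) + ω_r⁻¹·Σᵢ₌₁^{r−1} ωᵢ·∂ᵢ(λ) for all λ ∈ E. Then D(ω_r·u) = 1, D(ω_r²·u) = ω_r·u, D(ωₖ + ωₖ·u) = 0 for all 1 ≤ k ≤ r−1, and D∘D∘D = 0. -/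
open LaurentPolynomial

/-- In characteristic `3`, the third iterate of a derivation is a derivation. -/
def Derivation.thirdIterate {F R : Type*} [CommRing F] [CommRing R] [Algebra F R]
    (h3 : (3 : R) = 0) (D : Derivation F R R) : Derivation F R R :=
  Derivation.mk' (D.toLinearMap ∘ₗ D.toLinearMap ∘ₗ D.toLinearMap) fun a b => by
    simp only [LinearMap.comp_apply, Derivation.coeFn_coe,
      Derivation.leibniz, map_add, smul_eq_mul]
    linear_combination (D a * D (D b) + D b * D (D a)) * h3

theorem Derivation.thirdIterate_apply {F R : Type*} [CommRing F] [CommRing R] [Algebra F R]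
    (h3 : (3 : R) = 0) (D : Derivation F R R) (a : R) :
    D.thirdIterate h3 a = D (D (D a)) := rfl

/-- A derivation vanishing on two elements `a * b` and `b`, where `b` is regular, vanishes
on `a`. -/
theorem Derivation.eq_zero_of_mul_eq_zero {F R : Type*} [CommRing F] [CommRing R] [IsDomain R]
    [Algebra F R] (d : Derivation F R R) {a b : R} (hb : b ≠ 0) (hab : d (a * b) = 0)
    (hdb : d b = 0) : d a = 0 := by
  rw [Derivation.leibniz, hdb, smul_zero, zero_add, smul_eq_mul] at hab
  exact (mul_eq_zero.mp hab).resolve_left hb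

/-- A derivation of `E[T;T⁻¹]` vanishing on `T` and on a generating family of `E` is zero. -/
theorem LaurentPolynomial.derivation_eq_zero {F E ι : Type*} [Field F] [Field E] [Algebra F E]
    {ω : ι → E} (hω : Function.Surjective (MvPolynomial.aeval (R := F) ω))
    (d : Derivation F (LaurentPolynomial E) (LaurentPolynomial E))
    (hT : d (T 1) = 0) (hC : ∀ i, d (C (ω i)) = 0) (f : LaurentPolynomial E) : d f = 0 := by
  have hlam (lam : E) : d (C lam) = 0 := by
    obtain ⟨p, rfl⟩ := hω lam
    induction p using MvPolynomial.induction_on with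
    | C a =>
      rw [MvPolynomial.aeval_C]
      exact d.map_algebraMap a
    | add p q hp hq => rw [map_add, map_add, map_add, hp, hq, add_zero]
    | mul_X p i hp =>
      rw [map_mul, MvPolynomial.aeval_X, map_mul, d.leibniz, hp, hC, smul_zero, smul_zero,
        add_zero]
  have hT' : d (T (-1)) = 0 := by
    refine d.eq_zero_of_mul_eq_zero (b := T 1) (isUnit_T 1).ne_zero ?_ hT
    rw [← T_add, neg_add_cancel, T_zero, d.map_one_eq_zero]
  induction f using LaurentPolynomial.induction_on with
  | h_C a => exact hlam a
  | h_add hp hq => rw [map_add, hp, hq, add_zero]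
  | h_C_mul_T k a h =>
    rw [T_add, ← mul_assoc, d.leibniz, h, hT, smul_zero, smul_zero, add_zero]
  | h_C_mul_T_Z k a h =>
    rw [sub_eq_add_neg, T_add, ← mul_assoc, d.leibniz, h, hT', smul_zero, smul_zero, add_zero]

/-- (Here the length of the `p`-basis is `r = n + 1 ≥ 1`;
`ω_r = ω (Fin.last n)` and the indices `1 ≤ i ≤ r − 1` are the `i.castSucc`
for `i : Fin n`.) -/
theorem statement17 (F E : Type*) [Field F] [Field E] [Algebra F E] [CharP F 3]
    (n : ℕ) (ω : Fin (n + 1) → E) (hω : IsPBasis F 3 ω)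
    (der : Fin (n + 1) → Derivation F E E)
    (hder : ∀ i j, der i (ω j) = if i = j then (1 : E) else 0)
    (D : Derivation F (LaurentPolynomial E) (LaurentPolynomial E))
    (hDu : D (T 1) = -(C ((ω (Fin.last n))⁻¹) * (1 + T 1)))
    (hDC : ∀ lam : E, D (C lam) =
      (1 - T (-1)) * C (der (Fin.last n) lam) +
        C ((ω (Fin.last n))⁻¹) *
          ∑ i : Fin n, C (ω i.castSucc * der i.castSucc lam)) :
    D (C (ω (Fin.last n)) * T 1) = 1 ∧
    D (C (ω (Fin.last n) ^ 2) * T 1) = C (ω (Fin.last n)) * T 1 ∧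
    (∀ i : Fin n, D (C (ω i.castSucc) + C (ω i.castSucc) * T 1) = 0) ∧
    (∀ f, D (D (D f)) = 0) := by
  have h3 : (3 : LaurentPolynomial E) = 0 := by
    have := congrArg (algebraMap F (LaurentPolynomial E)) (CharP.cast_eq_zero F 3)
    simpa only [Nat.cast_ofNat, map_ofNat, map_zero] using this
  set x := ω (Fin.last n) with hx
  have hx0 : x ≠ 0 := fun h => by
    have := hder (Fin.last n) (Fin.last n)
    rw [← hx, h, map_zero, if_pos rfl] at this
    exact zero_ne_one this
  have hxx : (C x : LaurentPolynomial E) * C x⁻¹ = 1 := by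
    rw [← map_mul, mul_inv_cancel₀ hx0, map_one]
  have hTT : (T (-1) : LaurentPolynomial E) * T 1 = 1 := by
    rw [← T_add, neg_add_cancel, T_zero]
  have hDx : D (C x) = 1 - T (-1) := by
    rw [hDC]
    simp [hx, hder, Fin.castSucc_ne_last]
  have hDw (i : Fin n) : D (C (ω i.castSucc)) = C x⁻¹ * C (ω i.castSucc) := by
    rw [hDC, hder, if_neg (Fin.castSucc_ne_last i).symm, map_zero, mul_zero, zero_add,
      Finset.sum_eq_single i (fun j _ hj => by
        rw [hder, if_neg (by simpa using hj), mul_zero, map_zero]) (by simp),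
      hder, if_pos rfl, mul_one]
  have h1 : D (C x * T 1) = 1 := by
    rw [D.leibniz, hDu, hDx, smul_eq_mul, smul_eq_mul]
    linear_combination (-1 - T 1) * hxx - hTT - h3
  have h2 : D (C (x ^ 2) * T 1) = C x * T 1 := by
    have : (C (x ^ 2) * T 1 : LaurentPolynomial E) = C x * (C x * T 1) := by
      rw [map_pow]; ring
    rw [this, D.leibniz, h1, hDx, smul_eq_mul, smul_eq_mul]
    linear_combination -C x * hTT
  have hw (i : Fin n) : D (C (ω i.castSucc) + C (ω i.castSucc) * T 1) = 0 := by
    rw [map_add, D.leibniz, hDu, hDw, smul_eq_mul, smul_eq_mul]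
    ring
  refine ⟨h1, h2, hw, ?_⟩
  obtain ⟨-, -, hsurj, -⟩ := hω
  let d := D.thirdIterate h3
  have hd1 : d (C x * T 1) = 0 := by
    rw [Derivation.thirdIterate_apply, h1, D.map_one_eq_zero, map_zero]
  have hCx0 : (C x : LaurentPolynomial E) ≠ 0 := left_ne_zero_of_mul_eq_one hxx
  have hdx : d (C x) = 0 := by
    refine d.eq_zero_of_mul_eq_zero (mul_ne_zero hCx0 (isUnit_T 1).ne_zero) ?_ hd1
    have : (C x * (C x * T 1) : LaurentPolynomial E) = C (x ^ 2) * T 1 := by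
      rw [map_pow]; ring
    rw [this, Derivation.thirdIterate_apply, h2, h1, D.map_one_eq_zero]
  have hdT : d (T 1) = 0 :=
    d.eq_zero_of_mul_eq_zero hCx0 (by rwa [mul_comm]) hdx
  have hT0 : (1 + T 1 : LaurentPolynomial E) ≠ 0 := by
    have := Polynomial.toLaurent_ne_zero.mpr (Polynomial.X_add_C_ne_zero (1 : E))
    rwa [map_add, Polynomial.toLaurent_X, map_one, map_one, add_comm] at this
  have hdω (i : Fin (n + 1)) : d (C (ω i)) = 0 := by
    induction i using Fin.lastCases with
    | last => exact hdx
    | cast i =>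
      refine d.eq_zero_of_mul_eq_zero hT0 ?_ (by rw [map_add, d.map_one_eq_zero, hdT, add_zero])
      rw [mul_add, mul_one, Derivation.thirdIterate_apply, hw, map_zero, map_zero]
  exact LaurentPolynomial.derivation_eq_zero hsurj d hdT hdω
end

section
/- Let F ⊆ E be fields of characteristic 2 such that E admits a p-basis ω₁,…,ω_r over F (r ≥ 1), with dual derivations ∂₁,…,∂_r. Let D be an F-linear derivation of the Laurent polynomial ring E[u,u⁻¹] satisfying D(u) = ω_r⁻¹·(u⁻¹ + u) and D(λ) = (u⁻² + 1)·∂_r(λ) + ω_r⁻¹·(u⁻¹ + 1)·Σᵢ₌₁^{r−1} ωᵢ·∂ᵢ(λ) for all λ ∈ E. Then D(ω_r·u) = 0, D(ω_r·u²) = 1 + u², D(ωₖ + ωₖ·u) = 0 for all 1 ≤ k ≤ r−1, and D∘D = 0. -/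
open LaurentPolynomial

/-- In characteristic two the square of a derivation is again a derivation. -/
def Derivation.sqOfTwoEqZero {R A : Type*} [CommRing R] [CommRing A] [Algebra R A]
    (D : Derivation R A A) (h2 : (2 : A) = 0) : Derivation R A A :=
  Derivation.mk' (D.toLinearMap ∘ₗ D.toLinearMap) fun a b => by
    simp only [LinearMap.comp_apply, Derivation.coeFn_coe, Derivation.leibniz, map_add,
      smul_eq_mul]
    linear_combination D a * D b * h2

theorem Derivation.sqOfTwoEqZero_apply {R A : Type*} [CommRing R] [CommRing A] [Algebra R A]
    (D : Derivation R A A) (h2 : (2 : A) = 0) (a : A) : D.sqOfTwoEqZero h2 a = D (D a) := rfl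

/-- A derivation of a Laurent polynomial ring that kills the coefficients and the variable
is zero. -/
theorem LaurentPolynomial.derivation_eq_zero_s18 {R A : Type*} [CommRing R] [CommRing A]
    [Algebra R (LaurentPolynomial A)]
    (Δ : Derivation R (LaurentPolynomial A) (LaurentPolynomial A))
    (hC : ∀ a, Δ (C a) = 0) (hT : Δ (T 1) = 0) (f : LaurentPolynomial A) : Δ f = 0 := by
  have hT' : Δ (T (-1)) = 0 := by
    have hmul : (T (-1) : LaurentPolynomial A) * T 1 = 1 := by rw [← T_add]; simp
    rw [Derivation.leibniz_of_mul_eq_one Δ hmul, hT, smul_zero]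
  induction f using LaurentPolynomial.induction_on with
  | h_C a => exact hC a
  | h_add hp hq => rw [map_add, hp, hq, add_zero]
  | h_C_mul_T n a h =>
    rw [T_add, ← mul_assoc, Derivation.leibniz, h, hT, smul_zero, smul_zero, add_zero]
  | h_C_mul_T_Z n a h =>
    rw [sub_eq_add_neg, T_add, ← mul_assoc, Derivation.leibniz, h, hT', smul_zero, smul_zero,
      add_zero]

/-- A derivation of a Laurent polynomial ring that kills algebra generators of the coefficient
ring kills all coefficients. -/
theorem LaurentPolynomial.derivation_C_eq_zero {R A ι : Type*} [CommRing R] [CommRing A]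
    [Algebra R A] (Δ : Derivation R (LaurentPolynomial A) (LaurentPolynomial A)) (ω : ι → A)
    (hω : Function.Surjective (MvPolynomial.aeval (R := R) ω))
    (hΔ : ∀ i, Δ (C (ω i)) = 0) (a : A) : Δ (C a) = 0 := by
  obtain ⟨p, rfl⟩ := hω a
  induction p using MvPolynomial.induction_on with
  | C r =>
    rw [MvPolynomial.aeval_C]
    exact Δ.map_algebraMap r
  | add p q hp hq => rw [map_add, map_add, map_add, hp, hq, add_zero]
  | mul_X p i hp =>
    rw [map_mul, map_mul, Derivation.leibniz, hp, MvPolynomial.aeval_X, hΔ, smul_zero, smul_zero,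
      add_zero]

/-- (Here the length of the `p`-basis is `r = n + 1 ≥ 1`;
`ω_r = ω (Fin.last n)` and the indices `1 ≤ i ≤ r − 1` are the `i.castSucc`
for `i : Fin n`.) -/
theorem statement18 (F E : Type*) [Field F] [Field E] [Algebra F E] [CharP F 2]
    (n : ℕ) (ω : Fin (n + 1) → E) (hω : IsPBasis F 2 ω)
    (der : Fin (n + 1) → Derivation F E E)
    (hder : ∀ i j, der i (ω j) = if i = j then (1 : E) else 0)
    (D : Derivation F (LaurentPolynomial E) (LaurentPolynomial E))
    (hDu : D (T 1) = C ((ω (Fin.last n))⁻¹) * (T (-1) + T 1))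
    (hDC : ∀ lam : E, D (C lam) =
      (T (-2) + 1) * C (der (Fin.last n) lam) +
        C ((ω (Fin.last n))⁻¹) * (T (-1) + 1) *
          ∑ i : Fin n, C (ω i.castSucc * der i.castSucc lam)) :
    D (C (ω (Fin.last n)) * T 1) = 0 ∧
    D (C (ω (Fin.last n)) * T 2) = 1 + T 2 ∧
    (∀ i : Fin n, D (C (ω i.castSucc) + C (ω i.castSucc) * T 1) = 0) ∧
    (∀ f, D (D f) = 0) := by
  have h2 : (2 : LaurentPolynomial E) = 0 := by
    have hF : (2 : F) = 0 := CharTwo.two_eq_zero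
    have := congrArg (algebraMap F (LaurentPolynomial E)) hF
    rwa [map_ofNat, map_zero] at this
  have hw0 : ω (Fin.last n) ≠ 0 := by
    intro h
    have := hder (Fin.last n) (Fin.last n)
    rw [h, map_zero, if_pos rfl] at this
    exact zero_ne_one this
  have hwv : C (ω (Fin.last n)) * C ((ω (Fin.last n))⁻¹) = (1 : LaurentPolynomial E) := by
    rw [← map_mul, mul_inv_cancel₀ hw0, map_one]
  have hxy : (T 1 * T (-1) : LaurentPolynomial E) = 1 := by rw [← T_add]; simp
  have hT2 : (T 2 : LaurentPolynomial E) = T 1 * T 1 := by rw [← T_add]; rfl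
  have hTm2 : (T (-2) : LaurentPolynomial E) = T (-1) * T (-1) := by rw [← T_add]; rfl
  have hDw : D (C (ω (Fin.last n))) = T (-1) * T (-1) + 1 := by
    have hs (i : Fin n) : der i.castSucc (ω (Fin.last n)) = 0 := by
      rw [hder, if_neg (Fin.castSucc_lt_last i).ne]
    rw [hDC, hder, if_pos rfl, hTm2]
    simp [hs]
  have hDk (k : Fin n) : D (C (ω k.castSucc)) =
      C ((ω (Fin.last n))⁻¹) * (T (-1) + 1) * C (ω k.castSucc) := by
    rw [hDC, hder, if_neg (Fin.castSucc_lt_last k).ne', Finset.sum_eq_single k]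
    · simp [hder]
    · intro b _ hb
      rw [hder, if_neg (fun h => hb (Fin.castSucc_injective n h)), mul_zero, map_zero]
    · simp
  have h1 : D (C (ω (Fin.last n)) * T 1) = 0 := by
    rw [Derivation.leibniz, hDu, hDw, smul_eq_mul, smul_eq_mul]
    linear_combination (T (-1) + T 1) * hwv + T (-1) * hxy + (T (-1) + T 1) * h2
  have h3 (i : Fin n) : D (C (ω i.castSucc) + C (ω i.castSucc) * T 1) = 0 := by
    rw [map_add, Derivation.leibniz, hDu, hDk, smul_eq_mul, smul_eq_mul]
    linear_combination C ((ω (Fin.last n))⁻¹) * C (ω i.castSucc) *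
      (hxy + (T (-1) + T 1 + 1) * h2)
  have hDDw : D (D (C (ω (Fin.last n)))) = 0 := by
    rw [hDw, map_add, Derivation.leibniz, Derivation.map_one_eq_zero, smul_eq_mul]
    linear_combination T (-1) * D (T (-1)) * h2
  have hDDu : D (D (T 1)) = 0 := by
    have h : D.sqOfTwoEqZero h2 (C (ω (Fin.last n)) * T 1) = 0 := by
      rw [Derivation.sqOfTwoEqZero_apply, h1, map_zero]
    rw [Derivation.leibniz, Derivation.sqOfTwoEqZero_apply, Derivation.sqOfTwoEqZero_apply, hDDw,
      smul_zero, add_zero, smul_eq_mul] at h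
    linear_combination C ((ω (Fin.last n))⁻¹) * h - D (D (T 1)) * hwv
  have hDDk (k : Fin n) : D (D (C (ω k.castSucc))) = 0 := by
    have h : D.sqOfTwoEqZero h2 (C (ω k.castSucc) + C (ω k.castSucc) * T 1) = 0 := by
      rw [Derivation.sqOfTwoEqZero_apply, h3, map_zero]
    rw [map_add, Derivation.leibniz, Derivation.sqOfTwoEqZero_apply,
      Derivation.sqOfTwoEqZero_apply, hDDu, smul_zero, zero_add, smul_eq_mul] at h
    have hne : (1 + T 1 : LaurentPolynomial E) ≠ 0 := by
      have := (Polynomial.toLaurent_ne_zero (R := E)).mpr (Polynomial.X_add_C_ne_zero 1)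
      rwa [map_add, Polynomial.toLaurent_X, Polynomial.C_1, map_one, add_comm] at this
    refine (mul_eq_zero.mp ?_).resolve_left hne
    linear_combination h
  obtain ⟨-, -, hsurj, -⟩ := hω
  refine ⟨h1, ?_, h3, ?_⟩
  · rw [hT2, Derivation.leibniz, Derivation.leibniz, hDw]
    simp only [smul_eq_mul]
    linear_combination (T 1 * T (-1) + 1) * hxy + C (ω (Fin.last n)) * T 1 * D (T 1) * h2
  · refine LaurentPolynomial.derivation_eq_zero_s18 (D.sqOfTwoEqZero h2)
      (LaurentPolynomial.derivation_C_eq_zero _ ω hsurj fun i => ?_) hDDu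
    induction i using Fin.lastCases with
    | last => exact hDDw
    | cast k => exact hDDk k
end
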